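/- Let 1 < p < ∞, m ∈ ℕ, 0 ≤ ℓ < d and a ∈ ℝ. Then there exists a constant c such that the Moser-type inequality ‖u·v | 𝒦^m_{a,p}(ℝ^d,ℝ^ℓ_*)‖ ≤ c ( ‖u | 𝒦^m_{a,p}(ℝ^d,ℝ^ℓ_*)‖ · ‖v | L∞(ℝ^d)‖ + ‖v | 𝒦^m_{a,p}(ℝ^d,ℝ^ℓ_*)‖ · ‖u | L∞(ℝ^d)‖ ) holds for all u, v ∈ 𝒦^m_{a,p}(ℝ^d,ℝ^ℓ_*) ∩ L∞(ℝ^d). -/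

import Mathlib

open MeasureTheory Metric Set Filter
open scoped Topology ENNReal NNReal

noncomputable section

/-- `d`-dimensional Euclidean space. -/
abbrev Ed (d : ℕ) : Type := EuclideanSpace ℝ (Fin d)

/-- The finite set of all multi-indices `α : Fin d → ℕ` with `|α| = ∑ i, α i ≤ m`. -/
def multiIdx (d m : ℕ) : Finset (Fin d → ℕ) :=
  (Fintype.piFinset fun _ : Fin d => Finset.range (m + 1)).filter fun α => ∑ i, α i ≤ m

/-- First-order partial derivative in the `i`-th coordinate direction. -/
def pderivI (d : ℕ) (i : Fin d) (f : Ed d → ℝ) : Ed d → ℝ :=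
  fun x => fderiv ℝ f x (EuclideanSpace.single i 1)

/-- Iterated partial derivative `∂^α`. -/
def pderivA (d : ℕ) (α : Fin d → ℕ) (f : Ed d → ℝ) : Ed d → ℝ :=
  ((List.finRange d).foldr (fun i g => (pderivI d i)^[α i] ∘ g) id) f

/-- Smooth compactly supported test functions with support inside `Ω`. -/
def IsTestFun (d : ℕ) (Ω : Set (Ed d)) (φ : Ed d → ℝ) : Prop :=
  ContDiff ℝ (⊤ : ℕ∞) φ ∧ HasCompactSupport φ ∧ tsupport φ ⊆ Ω

/-- `v` is the `α`-th weak (distributional) derivative of `u` on `Ω`. -/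
def HasWeakDerivOn (d : ℕ) (Ω : Set (Ed d)) (α : Fin d → ℕ) (u v : Ed d → ℝ) : Prop :=
  LocallyIntegrableOn u Ω volume ∧ LocallyIntegrableOn v Ω volume ∧
    ∀ φ : Ed d → ℝ, IsTestFun d Ω φ →
      ∫ x in Ω, u x * pderivA d α φ x = (-1 : ℝ) ^ (∑ i, α i) * ∫ x in Ω, v x * φ x

/-- `D` is a family of weak derivatives of `u` on `Ω` for all multi-indices of order `≤ m`. -/
def IsWeakDerivFamily (d : ℕ) (Ω : Set (Ed d)) (m : ℕ) (u : Ed d → ℝ)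
    (D : (Fin d → ℕ) → Ed d → ℝ) : Prop :=
  ∀ α ∈ multiIdx d m, HasWeakDerivOn d Ω α u (D α)

/-- `x ↦ (ρ(x)^(|α|-a) |v(x)|)^p`, the integrand in the Kondratiev norm. -/
def kIntegrand (d : ℕ) (ρ : Ed d → ℝ) (a p : ℝ) (α : Fin d → ℕ) (v : Ed d → ℝ) : Ed d → ℝ :=
  fun x => (ρ x ^ (((∑ i, α i : ℕ) : ℝ) - a) * |v x|) ^ p

/-- The Kondratiev norm computed from a family `D` of weak derivatives. -/
def KnormP (d : ℕ) (Ω : Set (Ed d)) (ρ : Ed d → ℝ) (m : ℕ) (a p : ℝ)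
    (D : (Fin d → ℕ) → Ed d → ℝ) : ℝ :=
  (∑ α ∈ multiIdx d m, ∫ x in Ω, kIntegrand d ρ a p α (D α) x) ^ (1 / p)

/-- `D` witnesses membership of `u` in the Kondratiev space `𝒦^m_{a,p}(Ω, M)`
    (with weight function `ρ`). -/
def KMemData (d : ℕ) (Ω : Set (Ed d)) (ρ : Ed d → ℝ) (m : ℕ) (a p : ℝ)
    (u : Ed d → ℝ) (D : (Fin d → ℕ) → Ed d → ℝ) : Prop :=
  IsWeakDerivFamily d Ω m u D ∧
    ∀ α ∈ multiIdx d m, IntegrableOn (kIntegrand d ρ a p α (D α)) Ω volume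

/-- Membership in the Kondratiev space `𝒦^m_{a,p}(Ω, M)` with weight `ρ`, `p < ∞`. -/
def MemK (d : ℕ) (Ω : Set (Ed d)) (ρ : Ed d → ℝ) (m : ℕ) (a p : ℝ) (u : Ed d → ℝ) : Prop :=
  ∃ D, KMemData d Ω ρ m a p u D

open Classical in
/-- The Kondratiev norm of `u` (computed from a choice of weak derivative family;
    it is a.e. independent of this choice). -/
def Knorm (d : ℕ) (Ω : Set (Ed d)) (ρ : Ed d → ℝ) (m : ℕ) (a p : ℝ) (u : Ed d → ℝ) : ℝ :=
  if h : MemK d Ω ρ m a p u then KnormP d Ω ρ m a p h.choose else 0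

/-- `x ↦ ρ(x)^(|α|-a) v(x)`, the function whose `L_∞` norm enters the norm for `p = ∞`. -/
def kIntegrandInf (d : ℕ) (ρ : Ed d → ℝ) (a : ℝ) (α : Fin d → ℕ) (v : Ed d → ℝ) : Ed d → ℝ :=
  fun x => ρ x ^ (((∑ i, α i : ℕ) : ℝ) - a) * v x

/-- `D` witnesses membership of `u` in `𝒦^m_{a,∞}(Ω, M)`. -/
def KMemDataInf (d : ℕ) (Ω : Set (Ed d)) (ρ : Ed d → ℝ) (m : ℕ) (a : ℝ)
    (u : Ed d → ℝ) (D : (Fin d → ℕ) → Ed d → ℝ) : Prop :=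
  IsWeakDerivFamily d Ω m u D ∧
    ∀ α ∈ multiIdx d m,
      eLpNorm (kIntegrandInf d ρ a α (D α)) ⊤ (volume.restrict Ω) < ⊤

/-- Membership in `𝒦^m_{a,∞}(Ω, M)`. -/
def MemKInf (d : ℕ) (Ω : Set (Ed d)) (ρ : Ed d → ℝ) (m : ℕ) (a : ℝ) (u : Ed d → ℝ) : Prop :=
  ∃ D, KMemDataInf d Ω ρ m a u D

/-- The `𝒦^m_{a,∞}` norm computed from a family `D` of weak derivatives. -/
def KnormInfP (d : ℕ) (Ω : Set (Ed d)) (ρ : Ed d → ℝ) (m : ℕ) (a : ℝ)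
    (D : (Fin d → ℕ) → Ed d → ℝ) : ℝ :=
  ∑ α ∈ multiIdx d m, (eLpNorm (kIntegrandInf d ρ a α (D α)) ⊤ (volume.restrict Ω)).toReal

open Classical in
/-- The `𝒦^m_{a,∞}(Ω, M)` norm of `u`. -/
def KnormInf (d : ℕ) (Ω : Set (Ed d)) (ρ : Ed d → ℝ) (m : ℕ) (a : ℝ) (u : Ed d → ℝ) : ℝ :=
  if h : MemKInf d Ω ρ m a u then KnormInfP d Ω ρ m a h.choose else 0

/-- The subspace `ℝ^ℓ_* = {x : x₁ = ⋯ = x_{d-ℓ} = 0}` of `ℝ^d`. -/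
def RStar (d ℓ : ℕ) : Set (Ed d) := {x | ∀ i : Fin d, (i : ℕ) < d - ℓ → x i = 0}

/-- The weight `ρ(x) = min(1, |x'|)` for the model case `(ℝ^d, ℝ^ℓ_*)`. -/
def rhoModel (d ℓ : ℕ) (x : Ed d) : ℝ :=
  min 1 (Real.sqrt (∑ i ∈ Finset.univ.filter (fun i : Fin d => (i : ℕ) < d - ℓ), (x i) ^ 2))

/-- The model domain `ℝ^d ∖ ℝ^ℓ_*`. -/
def ModelDomain (d ℓ : ℕ) : Set (Ed d) := (RStar d ℓ)ᶜ

/-- Membership in the model Kondratiev space `𝒦^m_{a,p}(ℝ^d, ℝ^ℓ_*)`, `p < ∞`. -/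
def MemKM (d ℓ m : ℕ) (a p : ℝ) (u : Ed d → ℝ) : Prop :=
  MemK d (ModelDomain d ℓ) (rhoModel d ℓ) m a p u

/-- The norm of the model Kondratiev space `𝒦^m_{a,p}(ℝ^d, ℝ^ℓ_*)`, `p < ∞`. -/
def KnormM (d ℓ m : ℕ) (a p : ℝ) (u : Ed d → ℝ) : ℝ :=
  Knorm d (ModelDomain d ℓ) (rhoModel d ℓ) m a p u

/-- Membership in the model Kondratiev space `𝒦^m_{a,∞}(ℝ^d, ℝ^ℓ_*)`. -/
def MemKMInf (d ℓ m : ℕ) (a : ℝ) (u : Ed d → ℝ) : Prop :=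
  MemKInf d (ModelDomain d ℓ) (rhoModel d ℓ) m a u

/-- The norm of the model Kondratiev space `𝒦^m_{a,∞}(ℝ^d, ℝ^ℓ_*)`. -/
def KnormMInf (d ℓ m : ℕ) (a : ℝ) (u : Ed d → ℝ) : ℝ :=
  KnormInf d (ModelDomain d ℓ) (rhoModel d ℓ) m a u


/-- Average of `f` over the open ball of radius `r`. -/
def Av {d : ℕ} (r : ℝ) (f : Ed d → ℝ≥0∞) (x : Ed d) : ℝ≥0∞ :=
  (volume (ball (0 : Ed d) r))⁻¹ * ∫⁻ y in ball x r, f y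

/-- Maximal function with radii less than one. -/
def MM {d : ℕ} (f : Ed d → ℝ≥0∞) (x : Ed d) : ℝ≥0∞ :=
  ⨆ r : Ioo (0 : ℝ) 1, Av (r : ℝ) f x

lemma vol_ball_ne_zero {d : ℕ} {r : ℝ} (hr : 0 < r) (x : Ed d) : volume (ball x r) ≠ 0 :=
  (measure_ball_pos volume x hr).ne'

lemma vol_ball_ne_top {d : ℕ} (r : ℝ) (x : Ed d) : volume (ball x r) ≠ ⊤ :=
  measure_ball_lt_top.ne

lemma vol_ball_eq {d : ℕ} (r : ℝ) (x : Ed d) : volume (ball x r) = volume (ball (0 : Ed d) r) :=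
  Measure.addHaar_ball_center volume x r

lemma MM_measurable {d : ℕ} (f : Ed d → ℝ≥0∞) : Measurable (MM f) := by
  apply measurable_of_Ioi
  intro c
  apply IsOpen.measurableSet
  rw [Metric.isOpen_iff]
  intro x0 hx0
  obtain ⟨⟨r, hr⟩, hc⟩ := lt_iSup_iff.1 (show c < MM f x0 from hx0)
  simp only [Av] at hc
  have hU : ball x0 r = ⋃ n : ℕ, ball x0 (r - 1 / ((n : ℝ) + 1)) := by
    ext y
    simp only [mem_ball, mem_iUnion]
    constructor
    · intro h
      obtain ⟨n, hn⟩ := exists_nat_one_div_lt (sub_pos.2 h)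
      exact ⟨n, by linarith⟩
    · rintro ⟨n, hn⟩
      have : (0:ℝ) < 1 / ((n : ℝ) + 1) := by positivity
      linarith
  have hmono : Monotone (fun n : ℕ => ball x0 (r - 1 / ((n : ℝ) + 1))) := by
    intro a b hab
    apply ball_subset_ball
    have : 1 / ((b : ℝ) + 1) ≤ 1 / ((a : ℝ) + 1) := by
      apply one_div_le_one_div_of_le (by positivity)
      have : (a : ℝ) ≤ b := by exact_mod_cast hab
      linarith
    linarith
  have key : ∫⁻ y in ball x0 r, f y = ⨆ n : ℕ, ∫⁻ y in ball x0 (r - 1 / ((n : ℝ) + 1)), f y := by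
    have : ∀ s : Set (Ed d), MeasurableSet s → ∫⁻ y in s, f y = (volume.withDensity f) s :=
      fun s hs => (withDensity_apply f hs).symm
    rw [this _ measurableSet_ball, hU, hmono.measure_iUnion]
    simp only [this _ measurableSet_ball]
  rw [key, ENNReal.mul_iSup] at hc
  obtain ⟨n, hn⟩ := lt_iSup_iff.1 hc
  refine ⟨1 / ((n : ℝ) + 1), by positivity, ?_⟩
  intro x hx
  refine lt_of_lt_of_le hn (le_trans ?_ (le_iSup (fun r : Ioo (0 : ℝ) 1 => Av (r : ℝ) f x) ⟨r, hr⟩))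
  simp only [Av]
  gcongr
  intro y hy
  simp only [mem_ball] at *
  have := dist_triangle y x0 x
  rw [dist_comm] at hx
  linarith

lemma MM_mono {d : ℕ} {f g : Ed d → ℝ≥0∞} (h : f ≤ᵐ[volume] g) (x : Ed d) : MM f x ≤ MM g x := by
  unfold MM Av
  refine iSup_mono fun r => mul_le_mul_right ?_ _
  exact lintegral_mono_ae (ae_restrict_of_ae h)

/-- Weak type (1,1) estimate. -/
lemma MM_weak {d : ℕ} (f : Ed d → ℝ≥0∞) (c : ℝ≥0∞) (hc : c ≠ 0) (hc' : c ≠ ⊤) :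
    volume {x | c < MM f x} ≤ (5 : ℝ≥0∞) ^ d * c⁻¹ * ∫⁻ y, f y := by
  set S := {x | c < MM f x}
  have hS : ∀ x : S, ∃ r : ℝ, 0 < r ∧ r < 1 ∧ c < Av r f x.1 := by
    rintro ⟨x, hx⟩
    obtain ⟨⟨r, hr⟩, hc⟩ := lt_iSup_iff.1 (show c < MM f x from hx)
    exact ⟨r, hr.1, hr.2, hc⟩
  choose r hr0 hr1 hr using hS
  obtain ⟨u, -, hdis, hcov⟩ := Vitali.exists_disjoint_subfamily_covering_enlargement_closedBall
    (univ : Set S) (fun x => x.1) r 1 (fun a _ => (hr1 a).le) 5 (by norm_num)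
  have hcount : u.Countable := by
    apply hdis.countable_of_nonempty_interior
    intro a _
    exact ⟨a.1, mem_interior.2 ⟨ball a.1 (r a), ball_subset_closedBall, isOpen_ball,
      mem_ball_self (hr0 a)⟩⟩
  have hsub : S ⊆ ⋃ b ∈ u, closedBall b.1 (5 * r b) := by
    intro x hx
    obtain ⟨b, hb, hb'⟩ := hcov ⟨x, hx⟩ (mem_univ _)
    exact mem_iUnion₂.2 ⟨b, hb, hb' (mem_closedBall_self (hr0 _).le)⟩
  have hball : ∀ b : S, volume (closedBall b.1 (5 * r b)) ≤
      (5 : ℝ≥0∞) ^ d * c⁻¹ * ∫⁻ y in ball b.1 (r b), f y := by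
    intro b
    have h1 : volume (closedBall b.1 (5 * r b)) = 5 ^ d * volume (ball (0 : Ed d) (r b)) := by
      rw [Measure.addHaar_closedBall_mul volume _ (by norm_num : (0:ℝ) ≤ 5) (hr0 b).le,
        Measure.addHaar_closedBall volume _ (hr0 b).le, Measure.addHaar_ball_of_pos volume _ (hr0 b)]
      simp
    have h2 := hr b
    simp only [Av] at h2
    rw [h1, mul_assoc]
    gcongr
    rw [← ENNReal.div_eq_inv_mul, ENNReal.le_div_iff_mul_le (Or.inl hc) (Or.inl hc')]
    rw [← ENNReal.div_eq_inv_mul, ENNReal.lt_div_iff_mul_lt (Or.inl (vol_ball_ne_zero (hr0 b) _))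
      (Or.inl (vol_ball_ne_top _ _))] at h2
    rw [mul_comm]
    exact h2.le
  calc volume S ≤ volume (⋃ b ∈ u, closedBall b.1 (5 * r b)) := measure_mono hsub
    _ ≤ ∑' b : u, volume (closedBall b.1.1 (5 * r b)) := measure_biUnion_le _ hcount _
    _ ≤ ∑' b : u, (5 : ℝ≥0∞) ^ d * c⁻¹ * ∫⁻ y in ball b.1.1 (r b), f y :=
        ENNReal.tsum_le_tsum (fun b => hball b)
    _ = (5 : ℝ≥0∞) ^ d * c⁻¹ * ∑' b : u, ∫⁻ y in ball b.1.1 (r b), f y := ENNReal.tsum_mul_left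
    _ = (5 : ℝ≥0∞) ^ d * c⁻¹ * ∫⁻ y in ⋃ b ∈ u, ball b.1 (r b), f y := by
        rw [lintegral_biUnion hcount (fun _ _ => measurableSet_ball)]
        exact hdis.mono (fun a => ball_subset_closedBall)
    _ ≤ _ := by
        refine mul_le_mul_right ?_ _
        exact setLIntegral_le_lintegral _ _

lemma MM_weak' {d : ℕ} (f : Ed d → ℝ≥0∞) (hf : Measurable f) (c : ℝ≥0∞) (hc : c ≠ 0)
    (hc' : c ≠ ⊤) :
    volume {x | c < MM f x} ≤ (5 : ℝ≥0∞) ^ d * (2 * c⁻¹) * ∫⁻ y in {y | c / 2 < f y}, f y := by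
  have hms : MeasurableSet {y | c / 2 < f y} := measurableSet_lt measurable_const hf
  have h2 := MM_weak ({y | c / 2 < f y}.indicator f) (c / 2) (by simpa using hc)
    (by exact (ENNReal.div_lt_top hc' (by norm_num)).ne)
  rw [lintegral_indicator hms, ENNReal.inv_div (by simp) (by simp),
    div_eq_mul_inv 2 c] at h2
  refine le_trans (measure_mono ?_) h2
  intro x hx
  simp only [mem_setOf_eq] at hx ⊢
  have : MM f x ≤ c / 2 + MM ({y | c / 2 < f y}.indicator f) x := by
    apply iSup_le
    rintro ⟨r, hr⟩
    have h3 : Av r f x ≤ c / 2 + Av r ({y | c / 2 < f y}.indicator f) x := by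
      have : ∫⁻ y in ball x r, f y ≤ c / 2 * volume (ball (0 : Ed d) r) +
          ∫⁻ y in ball x r, ({y | c / 2 < f y}.indicator f) y := by
        calc ∫⁻ y in ball x r, f y ≤ ∫⁻ y in ball x r, (c / 2 + ({y | c / 2 < f y}.indicator f) y) := by
              apply lintegral_mono
              intro y
              by_cases h : c / 2 < f y
              · simp [indicator, h]
              · simp only [indicator, mem_setOf_eq, h, if_false, add_zero]
                exact not_lt.1 h
          _ = _ := by
              rw [lintegral_add_left measurable_const]
              simp [vol_ball_eq r x]
      simp only [Av]
      calc _ ≤ (volume (ball (0 : Ed d) r))⁻¹ * (c / 2 * volume (ball (0 : Ed d) r) +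
          ∫⁻ y in ball x r, ({y | c / 2 < f y}.indicator f) y) := by gcongr
        _ = _ := by
          rw [mul_add, mul_comm (c / 2), ← mul_assoc, ENNReal.inv_mul_cancel
            (vol_ball_ne_zero hr.1 _) (vol_ball_ne_top _ _), one_mul]
    exact h3.trans (by gcongr; exact le_iSup (fun r : Ioo (0 : ℝ) 1 => Av (r : ℝ) _ x) ⟨r, hr⟩)
  by_contra hcon
  push Not at hcon
  have h4 : MM f x ≤ c / 2 + c / 2 := this.trans (by gcongr)
  rw [ENNReal.add_halves] at h4
  exact absurd hx (not_lt.2 h4)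


lemma inner_rpow_bound (p : ℝ) (hp : 1 < p) (z : ℝ≥0∞) :
    ∫⁻ t in Ioi (0:ℝ), ENNReal.ofReal (t ^ (p - 2)) * (if ENNReal.ofReal t / 2 < z then z else 0) ≤
      ENNReal.ofReal (2 ^ (p - 1) / (p - 1)) * z ^ p := by
  have hp1 : 0 < p - 1 := by linarith
  have hC : 0 < (2:ℝ) ^ (p - 1) / (p - 1) := by positivity
  by_cases hz : z = ⊤
  · rw [hz, ENNReal.top_rpow_of_pos (by linarith), ENNReal.mul_top]
    · exact le_top
    · simpa using hC
  obtain ⟨b, hb, rfl⟩ : ∃ b : ℝ, 0 ≤ b ∧ z = ENNReal.ofReal b :=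
    ⟨z.toReal, ENNReal.toReal_nonneg, (ENNReal.ofReal_toReal hz).symm⟩
  calc _ ≤ ∫⁻ t in Ioi (0:ℝ), (Ioc 0 (2 * b)).indicator
          (fun t => ENNReal.ofReal b * ENNReal.ofReal (t ^ (p - 2))) t := by
        apply setLIntegral_mono' measurableSet_Ioi
        intro t ht
        have ht : 0 < t := ht
        split_ifs with h
        · rw [indicator_of_mem, mul_comm]
          refine ⟨ht, ?_⟩
          have : ENNReal.ofReal t / 2 = ENNReal.ofReal (t / 2) := by
            rw [ENNReal.ofReal_div_of_pos (by norm_num)]; simp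
          rw [this] at h
          have := ((ENNReal.ofReal_lt_ofReal_iff_of_nonneg (by positivity)).1 h)
          linarith
        · simp
    _ ≤ ∫⁻ t, (Ioc 0 (2 * b)).indicator
          (fun t => ENNReal.ofReal b * ENNReal.ofReal (t ^ (p - 2))) t := setLIntegral_le_lintegral _ _
    _ = ENNReal.ofReal b * ∫⁻ t in Ioc 0 (2 * b), ENNReal.ofReal (t ^ (p - 2)) := by
        rw [lintegral_indicator measurableSet_Ioc, lintegral_const_mul' _ _ (by simp)]
    _ = ENNReal.ofReal b * ENNReal.ofReal ((2 * b) ^ (p - 1) / (p - 1)) := by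
        congr 1
        have hIntg : IntervalIntegrable (fun t : ℝ => t ^ (p - 2)) volume 0 (2 * b) :=
          intervalIntegral.intervalIntegrable_rpow' (by linarith)
        rw [intervalIntegrable_iff_integrableOn_Ioc_of_le (by positivity)] at hIntg
        rw [← ofReal_integral_eq_lintegral_ofReal hIntg]
        · rw [← intervalIntegral.integral_of_le (by positivity), integral_rpow (Or.inl (by linarith))]
          have : p - 2 + 1 = p - 1 := by ring
          rw [this, Real.zero_rpow hp1.ne', sub_zero]
        · filter_upwards [ae_restrict_mem measurableSet_Ioc] with t ht
          exact Real.rpow_nonneg ht.1.le _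
    _ ≤ _ := by
        rw [ENNReal.ofReal_rpow_of_nonneg hb (by linarith), ← ENNReal.ofReal_mul hb,
          ← ENNReal.ofReal_mul hC.le]
        apply ENNReal.ofReal_le_ofReal
        rw [Real.mul_rpow (by norm_num) hb]
        rcases hb.eq_or_lt with h | h
        · rw [← h]
          simp [Real.zero_rpow hp1.ne', Real.zero_rpow (by linarith : p ≠ 0)]
        · have : b ^ p = b * b ^ (p - 1) := by
            rw [Real.rpow_sub_one h.ne']; field_simp
          rw [this]
          apply le_of_eq
          ring

/-- Strong type (p,p) estimate for the maximal function. -/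
lemma MM_strong (d : ℕ) (p : ℝ) (hp : 1 < p) : ∃ C : ℝ≥0∞, C ≠ ⊤ ∧
    ∀ f : Ed d → ℝ≥0∞, Measurable f → ∫⁻ x, (MM f x) ^ p ≤ C * ∫⁻ x, (f x) ^ p := by
  have hp0 : 0 < p := by linarith
  refine ⟨ENNReal.ofReal p * (5 ^ d * 2 * ENNReal.ofReal (2 ^ (p - 1) / (p - 1))), ?_, ?_⟩
  · exact ENNReal.mul_ne_top (by simp) (ENNReal.mul_ne_top (ENNReal.mul_ne_top (by simp) (by simp))
      (by simp))
  intro f hf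
  set C := ENNReal.ofReal p * (5 ^ d * 2 * ENNReal.ofReal (2 ^ (p - 1) / (p - 1)))
  have hM := MM_measurable f
  have key : ∀ n : ℕ, ∫⁻ x, (min (MM f x) n) ^ p ≤ C * ∫⁻ x, (f x) ^ p := by
    intro n
    set g : Ed d → ℝ := fun x => (min (MM f x) n).toReal with hg
    have hne : ∀ x, min (MM f x) n ≠ ⊤ := fun x =>
      ne_top_of_le_ne_top (ENNReal.natCast_ne_top n) (min_le_right _ _)
    have hgm : Measurable g := (hM.min measurable_const).ennreal_toReal
    have h1 : ∀ x, (min (MM f x) n) ^ p = ENNReal.ofReal (g x ^ p) := by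
      intro x
      rw [← ENNReal.ofReal_rpow_of_nonneg ENNReal.toReal_nonneg hp0.le, ENNReal.ofReal_toReal (hne x)]
    simp_rw [h1]
    rw [lintegral_rpow_eq_lintegral_meas_lt_mul volume
      (Eventually.of_forall fun x => ENNReal.toReal_nonneg) hgm.aemeasurable hp0]
    simp only [C]
    rw [mul_assoc (ENNReal.ofReal p)]
    refine mul_le_mul_right ?_ _
    calc _ ≤ ∫⁻ t in Ioi (0:ℝ), 5 ^ d * 2 * ∫⁻ y, (ENNReal.ofReal (t ^ (p - 2)) *
            (if ENNReal.ofReal t / 2 < f y then f y else 0)) := by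
          apply setLIntegral_mono' measurableSet_Ioi
          intro t ht
          have ht : 0 < t := ht
          have h2 : volume {a | t < g a} ≤ volume {x | ENNReal.ofReal t < MM f x} := by
            apply measure_mono
            intro x hx
            have hx : t < g x := hx
            show ENNReal.ofReal t < MM f x
            refine lt_of_lt_of_le ?_ (min_le_left (MM f x) n)
            exact (ENNReal.ofReal_lt_iff_lt_toReal ht.le (hne x)).2 hx
          have h3 := h2.trans (MM_weak' f hf (ENNReal.ofReal t) (by simpa using ht) (by simp))
          have hms : MeasurableSet {y | ENNReal.ofReal t / 2 < f y} :=
            measurableSet_lt measurable_const hf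
          rw [lintegral_const_mul' _ _ (by simp)]
          have h4 : ∫⁻ y, (if ENNReal.ofReal t / 2 < f y then f y else 0) =
              ∫⁻ y in {y | ENNReal.ofReal t / 2 < f y}, f y := by
            rw [← lintegral_indicator hms]
            refine lintegral_congr fun y => ?_
            by_cases h : ENNReal.ofReal t / 2 < f y <;> simp [indicator, h]
          rw [h4]
          have h5 : (ENNReal.ofReal t)⁻¹ * ENNReal.ofReal (t ^ (p - 1)) = ENNReal.ofReal (t ^ (p - 2)) := by
            rw [← ENNReal.ofReal_inv_of_pos ht, ← ENNReal.ofReal_mul (by positivity)]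
            congr 1
            rw [show p - 2 = p - 1 - 1 by ring, Real.rpow_sub_one ht.ne' (p - 1), div_eq_inv_mul]
          rw [← h5]
          calc _ ≤ (5 ^ d * (2 * (ENNReal.ofReal t)⁻¹) * ∫⁻ y in {y | ENNReal.ofReal t / 2 < f y}, f y) *
              ENNReal.ofReal (t ^ (p - 1)) := mul_le_mul_left h3 _
            _ = _ := by ring
      _ = 5 ^ d * 2 * ∫⁻ t in Ioi (0:ℝ), ∫⁻ y, (ENNReal.ofReal (t ^ (p - 2)) *
            (if ENNReal.ofReal t / 2 < f y then f y else 0)) :=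
          lintegral_const_mul' _ _ (ENNReal.mul_ne_top (by simp) (by simp))
      _ = 5 ^ d * 2 * ∫⁻ y, ∫⁻ t in Ioi (0:ℝ), (ENNReal.ofReal (t ^ (p - 2)) *
            (if ENNReal.ofReal t / 2 < f y then f y else 0)) := by
          rw [lintegral_lintegral_swap]
          apply Measurable.aemeasurable
          apply Measurable.mul
          · exact (measurable_fst.pow_const _).ennreal_ofReal
          · refine Measurable.ite ?_ (hf.comp measurable_snd) measurable_const
            exact measurableSet_lt ((measurable_fst.ennreal_ofReal).div_const _) (hf.comp measurable_snd)
      _ ≤ 5 ^ d * 2 * ∫⁻ y, ENNReal.ofReal (2 ^ (p - 1) / (p - 1)) * (f y) ^ p := by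
          refine mul_le_mul_right (lintegral_mono fun y => inner_rpow_bound p hp (f y)) _
      _ = _ := by
          rw [lintegral_const_mul' _ _ (by simp)]
          ring
  have hsup : ∀ x, (MM f x) ^ p = ⨆ n : ℕ, (min (MM f x) n) ^ p := by
    intro x
    have : MM f x = ⨆ n : ℕ, min (MM f x) n := by
      rw [← inf_iSup_eq, ENNReal.iSup_natCast, inf_top_eq]
    conv_lhs => rw [this]
    exact (ENNReal.orderIsoRpow p hp0).map_iSup _
  simp_rw [hsup]
  rw [lintegral_iSup]
  · exact iSup_le key
  · intro n
    exact (hM.min measurable_const).pow_const _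
  · intro a b hab x
    apply ENNReal.rpow_le_rpow _ hp0.le
    exact min_le_min le_rfl (by exact_mod_cast hab)

/-- Iterated version. -/
lemma MM_iter_strong (d : ℕ) (p : ℝ) (hp : 1 < p) (k : ℕ) : ∃ C : ℝ≥0∞, C ≠ ⊤ ∧
    ∀ f : Ed d → ℝ≥0∞, Measurable f → Measurable (MM^[k] f) ∧
      ∫⁻ x, (MM^[k] f x) ^ p ≤ C * ∫⁻ x, (f x) ^ p := by
  obtain ⟨C, hC, h⟩ := MM_strong d p hp
  induction k with
  | zero => exact ⟨1, by simp, fun f hf => ⟨hf, by simp⟩⟩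
  | succ k ih =>
    obtain ⟨C', hC', h'⟩ := ih
    refine ⟨C' * C, ENNReal.mul_ne_top hC' hC, fun f hf => ?_⟩
    rw [Function.iterate_succ, Function.comp_apply]
    refine ⟨(h' _ (MM_measurable f)).1, ?_⟩
    rw [mul_assoc]
    exact ((h' _ (MM_measurable f)).2).trans (mul_le_mul_right (h f hf) _)


/-- Unit multi-index. -/
abbrev ee {d : ℕ} (i : Fin d) : Fin d → ℕ := Pi.single i 1

lemma mem_multiIdx {d m : ℕ} {α : Fin d → ℕ} : α ∈ multiIdx d m ↔ ∑ i, α i ≤ m := by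
  simp only [multiIdx, Finset.mem_filter, Fintype.mem_piFinset, Finset.mem_range]
  refine ⟨fun h => h.2, fun h => ⟨fun i => ?_, h⟩⟩
  have := Finset.single_le_sum (f := α) (fun i _ => Nat.zero_le _) (Finset.mem_univ i)
  omega

lemma sum_add_single {d : ℕ} (α : Fin d → ℕ) (i : Fin d) :
    ∑ j, (α + ee i) j = (∑ j, α j) + 1 := by
  simp [Finset.sum_add_distrib]

lemma idx_induction {d : ℕ} {P : (Fin d → ℕ) → Prop} (h0 : P 0)
    (hs : ∀ α i, P α → P (α + ee i)) : ∀ α, P α := by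
  have : ∀ n : ℕ, ∀ α : Fin d → ℕ, ∑ i, α i = n → P α := by
    intro n
    induction n with
    | zero =>
      intro α hα
      have : α = 0 := by
        ext i
        have := Finset.sum_eq_zero_iff.1 hα i (Finset.mem_univ i)
        simpa using this
      rw [this]; exact h0
    | succ n ih =>
      intro α hα
      obtain ⟨i, hi⟩ : ∃ i, α i ≠ 0 := by
        by_contra hcon
        push Not at hcon
        simp [hcon] at hα
      have h1 : α = (α - ee i) + ee i := by
        ext j
        by_cases hj : j = i
        · subst hj; simp; omega
        · simp [hj]
      rw [h1]
      apply hs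
      apply ih
      have h2 := sum_add_single (α - ee i) i
      rw [← h1, hα] at h2
      omega
  intro α
  exact this _ α rfl

/-- Smoothness, abbreviated. -/
abbrev Smth {d : ℕ} (f : Ed d → ℝ) : Prop := ContDiff ℝ (⊤ : ℕ∞) f

lemma smth_pderivI {d : ℕ} {f : Ed d → ℝ} (hf : Smth f) (i : Fin d) : Smth (pderivI d i f) := by
  unfold pderivI
  exact (hf.fderiv_right (m := (⊤ : ℕ∞)) (by simp)).clm_apply contDiff_const

lemma smth_differentiable {d : ℕ} {f : Ed d → ℝ} (hf : Smth f) : Differentiable ℝ f :=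
  ContDiff.differentiable hf (by simp)

lemma pderivI_comm {d : ℕ} {f : Ed d → ℝ} (hf : Smth f) (i j : Fin d) :
    pderivI d i (pderivI d j f) = pderivI d j (pderivI d i f) := by
  have h1 : ∀ (i j : Fin d) x, pderivI d i (pderivI d j f) x =
      fderiv ℝ (fderiv ℝ f) x (EuclideanSpace.single i 1) (EuclideanSpace.single j 1) := by
    intro i j x
    unfold pderivI
    have hd : DifferentiableAt ℝ (fderiv ℝ f) x :=
      ((hf.fderiv_right (m := (⊤ : ℕ∞)) (by simp)).differentiable (by simp)) x
    rw [fderiv_clm_apply hd (differentiableAt_const _)]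
    simp
  ext x
  rw [h1, h1]
  have hs : IsSymmSndFDerivAt ℝ f x := by
    apply (hf.contDiffAt).isSymmSndFDerivAt
    simp only [minSmoothness_of_isRCLikeNormedField]
    exact WithTop.coe_le_coe.2 le_top
  exact hs.eq _ _

lemma smth_iter {d : ℕ} {f : Ed d → ℝ} (hf : Smth f) (i : Fin d) (n : ℕ) :
    Smth ((pderivI d i)^[n] f) := by
  induction n with
  | zero => exact hf
  | succ n ih => rw [Function.iterate_succ_apply']; exact smth_pderivI ih i

lemma pderivI_iter_comm {d : ℕ} {f : Ed d → ℝ} (hf : Smth f) (i j : Fin d) (n : ℕ) :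
    pderivI d i ((pderivI d j)^[n] f) = (pderivI d j)^[n] (pderivI d i f) := by
  induction n with
  | zero => rfl
  | succ n ih =>
    rw [Function.iterate_succ_apply', Function.iterate_succ_apply', pderivI_comm (smth_iter hf j n), ih]

/-- Partial version of `pderivA` along a list. -/
def PL {d : ℕ} (α : Fin d → ℕ) (l : List (Fin d)) (f : Ed d → ℝ) : Ed d → ℝ :=
  (l.foldr (fun i g => (pderivI d i)^[α i] ∘ g) id) f

lemma PL_cons {d : ℕ} (α : Fin d → ℕ) (j : Fin d) (l : List (Fin d)) (f : Ed d → ℝ) :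
    PL α (j :: l) f = (pderivI d j)^[α j] (PL α l f) := rfl

lemma PL_smth {d : ℕ} (α : Fin d → ℕ) (l : List (Fin d)) {f : Ed d → ℝ} (hf : Smth f) :
    Smth (PL α l f) := by
  induction l with
  | nil => exact hf
  | cons j l ih => rw [PL_cons]; exact smth_iter ih _ _

lemma PL_comm {d : ℕ} (α : Fin d → ℕ) (l : List (Fin d)) {f : Ed d → ℝ} (hf : Smth f) (i : Fin d) :
    pderivI d i (PL α l f) = PL α l (pderivI d i f) := by
  induction l with
  | nil => rfl
  | cons j l ih => rw [PL_cons, PL_cons, pderivI_iter_comm (PL_smth α l hf), ih]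

lemma PL_notMem {d : ℕ} (α : Fin d → ℕ) (l : List (Fin d)) (f : Ed d → ℝ) (i : Fin d)
    (hi : i ∉ l) : PL (α + ee i) l f = PL α l f := by
  induction l with
  | nil => rfl
  | cons j l ih =>
    simp only [List.mem_cons, not_or] at hi
    rw [PL_cons, PL_cons, ih hi.2]
    have : (α + ee i) j = α j := by simp [Ne.symm hi.1]
    rw [this]

lemma PL_mem {d : ℕ} (α : Fin d → ℕ) (l : List (Fin d)) (hl : l.Nodup) {f : Ed d → ℝ} (hf : Smth f)
    (i : Fin d) (hi : i ∈ l) : PL (α + ee i) l f = PL α l (pderivI d i f) := by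
  induction l with
  | nil => simp at hi
  | cons j l ih =>
    rw [List.nodup_cons] at hl
    rw [PL_cons, PL_cons]
    by_cases hij : i = j
    · subst hij
      rw [PL_notMem _ _ _ _ hl.1, ← PL_comm α l hf]
      have : (α + ee i) i = α i + 1 := by simp
      rw [this, Function.iterate_succ_apply]
    · have hi' : i ∈ l := by
        rcases List.mem_cons.1 hi with h | h
        · exact absurd h hij
        · exact h
      rw [ih hl.2 hi']
      have : (α + ee i) j = α j := by simp [Ne.symm hij]
      rw [this]

lemma pderivA_zero {d : ℕ} (f : Ed d → ℝ) : pderivA d 0 f = f := by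
  show PL 0 (List.finRange d) f = f
  induction List.finRange d with
  | nil => rfl
  | cons j l ih => rw [PL_cons, ih]; rfl

lemma pderivA_succ {d : ℕ} (α : Fin d → ℕ) (i : Fin d) {f : Ed d → ℝ} (hf : Smth f) :
    pderivA d (α + ee i) f = pderivA d α (pderivI d i f) :=
  PL_mem α _ (List.nodup_finRange d) hf i (List.mem_finRange i)

lemma smth_pderivA {d : ℕ} (α : Fin d → ℕ) {f : Ed d → ℝ} (hf : Smth f) : Smth (pderivA d α f) :=
  PL_smth α _ hf

lemma test_pderivI {d : ℕ} {Ω : Set (Ed d)} {φ : Ed d → ℝ} (h : IsTestFun d Ω φ) (i : Fin d) :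
    IsTestFun d Ω (pderivI d i φ) := by
  have hs : tsupport (pderivI d i φ) ⊆ tsupport φ := by
    refine closure_minimal ?_ (isClosed_tsupport φ)
    intro x hx
    apply support_fderiv_subset ℝ
    intro h0
    apply hx
    unfold pderivI
    rw [h0]; rfl
  refine ⟨smth_pderivI h.1 i, ?_, hs.trans h.2.2⟩
  exact h.2.1.of_isClosed_subset (isClosed_tsupport _) hs

lemma test_pderivA {d : ℕ} {Ω : Set (Ed d)} (α : Fin d → ℕ) :
    ∀ {φ : Ed d → ℝ}, IsTestFun d Ω φ → IsTestFun d Ω (pderivA d α φ) := by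
  induction α using idx_induction with
  | h0 => intro φ h; rw [pderivA_zero]; exact h
  | hs α i ih => intro φ h; rw [pderivA_succ α i h.1]; exact ih (test_pderivI h i)

lemma pderivI_scale {d : ℕ} {f : Ed d → ℝ} (hf : Smth f) (k c : ℝ) (x : Ed d) (i : Fin d) :
    pderivI d i (fun y => k * f (c • (x - y))) =
      fun y => (k * (-c)) * pderivI d i f (c • (x - y)) := by
  ext y
  unfold pderivI
  have h1 : HasFDerivAt (fun y : Ed d => c • (x - y)) (c • (-ContinuousLinearMap.id ℝ (Ed d))) y := by
    have : HasFDerivAt (fun y : Ed d => x - y) (-ContinuousLinearMap.id ℝ (Ed d)) y :=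
      (hasFDerivAt_id y).const_sub x
    exact this.const_smul c
  have h2 := ((smth_differentiable hf (c • (x - y))).hasFDerivAt.comp y h1).const_mul k
  have h3 : fderiv ℝ (fun y => k * f (c • (x - y))) y = _ := h2.fderiv
  rw [h3]
  simp
  ring

lemma pderivA_scale {d : ℕ} (α : Fin d → ℕ) (c : ℝ) (x : Ed d) :
    ∀ {f : Ed d → ℝ} (_ : Smth f) (k : ℝ),
    pderivA d α (fun y => k * f (c • (x - y))) =
      fun y => (k * (-c) ^ (∑ i, α i)) * pderivA d α f (c • (x - y)) := by
  induction α using idx_induction with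
  | h0 => intro f hf k; simp [pderivA_zero]
  | hs α i ih =>
    intro f hf k
    have hF : Smth (fun y => k * f (c • (x - y))) :=
      contDiff_const.mul (ContDiff.comp hf ((contDiff_const.sub contDiff_id).const_smul c))
    rw [pderivA_succ α i hF, pderivI_scale hf, ih (smth_pderivI hf i), pderivA_succ α i hf, sum_add_single]
    ext y
    ring


/-- Admissible convolution kernels. -/
def IsKer {d : ℕ} (f : Ed d → ℝ) : Prop := Smth f ∧ tsupport f ⊆ ball 0 1

/-- Rescaled kernel. -/
def Ker {d : ℕ} (f : Ed d → ℝ) (s : ℝ) (x y : Ed d) : ℝ := (s ^ d)⁻¹ * f (s⁻¹ • (x - y))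

lemma isKer_compact {d : ℕ} {f : Ed d → ℝ} (hf : IsKer f) : HasCompactSupport f :=
  (isCompact_closedBall (0 : Ed d) 1).of_isClosed_subset (isClosed_tsupport f)
    (hf.2.trans ball_subset_closedBall)

lemma isKer_test {d : ℕ} {f : Ed d → ℝ} (hf : IsKer f) : IsTestFun d (ball 0 1) f :=
  ⟨hf.1, isKer_compact hf, hf.2⟩

lemma isKer_pderivA {d : ℕ} {f : Ed d → ℝ} (hf : IsKer f) (α : Fin d → ℕ) :
    IsKer (pderivA d α f) :=
  let h := test_pderivA α (isKer_test hf)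
  ⟨h.1, h.2.2⟩

lemma isKer_pderivI {d : ℕ} {f : Ed d → ℝ} (hf : IsKer f) (i : Fin d) :
    IsKer (pderivI d i f) :=
  let h := test_pderivI (isKer_test hf) i
  ⟨h.1, h.2.2⟩

lemma isKer_bdd {d : ℕ} {f : Ed d → ℝ} (hf : IsKer f) : ∃ B : ℝ, 0 ≤ B ∧ ∀ z, |f z| ≤ B := by
  obtain ⟨B, hB⟩ := (isKer_compact hf).exists_bound_of_continuous hf.1.continuous
  exact ⟨B, (norm_nonneg _).trans (hB 0), hB⟩

lemma isKer_zero {d : ℕ} {f : Ed d → ℝ} (hf : IsKer f) {z : Ed d} (hz : 1 ≤ ‖z‖) : f z = 0 := by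
  by_contra h
  have := hf.2 (subset_tsupport f h)
  simp at this
  linarith

lemma ker_zero {d : ℕ} {f : Ed d → ℝ} (hf : IsKer f) {s : ℝ} (hs : 0 < s) {x y : Ed d}
    (hy : y ∉ ball x s) : Ker f s x y = 0 := by
  unfold Ker
  rw [isKer_zero hf, mul_zero]
  rw [norm_smul, norm_inv, Real.norm_of_nonneg hs.le, inv_mul_eq_div, le_div_iff₀ hs, one_mul]
  rw [mem_ball, not_lt, dist_comm, dist_eq_norm] at hy
  exact hy

lemma ker_smth {d : ℕ} {f : Ed d → ℝ} (hf : Smth f) (s : ℝ) (x : Ed d) : Smth (Ker f s x) :=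
  contDiff_const.mul (ContDiff.comp hf ((contDiff_const.sub contDiff_id).const_smul s⁻¹))

lemma ker_test {d : ℕ} {f : Ed d → ℝ} (hf : IsKer f) {s : ℝ} (hs : 0 < s) {x : Ed d}
    {Ω : Set (Ed d)} (hΩ : closedBall x s ⊆ Ω) : IsTestFun d Ω (Ker f s x) := by
  have hsub : tsupport (Ker f s x) ⊆ closedBall x s := by
    refine closure_minimal ?_ isClosed_closedBall
    intro y hy
    by_contra h
    exact hy (ker_zero hf hs (fun h' => h (ball_subset_closedBall h')))
  exact ⟨ker_smth hf.1 s x, (isCompact_closedBall x s).of_isClosed_subset (isClosed_tsupport _) hsub,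
    hsub.trans hΩ⟩

lemma ker_bound {d : ℕ} {f : Ed d → ℝ} (hf : IsKer f) : ∃ C : ℝ≥0∞, C ≠ ⊤ ∧
    ∀ s : ℝ, 0 < s → ∀ (x : Ed d) (g : Ed d → ℝ≥0∞),
      ∫⁻ y, ‖Ker f s x y‖ₑ * g y ≤ C * Av s g x := by
  obtain ⟨B, hB0, hB⟩ := isKer_bdd hf
  refine ⟨ENNReal.ofReal B * volume (ball (0 : Ed d) 1),
    ENNReal.mul_ne_top (by simp) (vol_ball_ne_top _ _), ?_⟩
  intro s hs x g
  have hv : volume (ball (0 : Ed d) s) = ENNReal.ofReal (s ^ d) * volume (ball (0 : Ed d) 1) := by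
    rw [Measure.addHaar_ball_of_pos volume _ hs]; simp
  have hv1 := vol_ball_ne_zero (d := d) one_pos 0
  have hv2 := vol_ball_ne_top (d := d) 1 0
  have hsd : 0 < s ^ d := by positivity
  calc ∫⁻ y, ‖Ker f s x y‖ₑ * g y ≤ ∫⁻ y, (ball x s).indicator
        (fun y => (ENNReal.ofReal ((s ^ d)⁻¹ * B)) * g y) y := by
        apply lintegral_mono
        intro y
        by_cases hy : y ∈ ball x s
        · rw [indicator_of_mem hy]
          refine mul_le_mul_left ?_ _
          rw [← ofReal_norm]
          apply ENNReal.ofReal_le_ofReal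
          unfold Ker
          rw [norm_mul, Real.norm_of_nonneg (by positivity)]
          gcongr
          exact hB _
        · simp [ker_zero hf hs hy]
    _ = ENNReal.ofReal ((s ^ d)⁻¹ * B) * ∫⁻ y in ball x s, g y := by
        rw [lintegral_indicator measurableSet_ball, lintegral_const_mul' _ _ (by simp)]
    _ = _ := by
        unfold Av
        rw [hv, ENNReal.mul_inv (Or.inr hv2) (Or.inr hv1), ENNReal.ofReal_mul (by positivity),
          ENNReal.ofReal_inv_of_pos hsd]
        calc _ = (ENNReal.ofReal (s ^ d))⁻¹ * ENNReal.ofReal B * (volume (ball (0 : Ed d) 1) *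
              (volume (ball (0 : Ed d) 1))⁻¹) * ∫⁻ y in ball x s, g y := by
              rw [ENNReal.mul_inv_cancel hv1 hv2, mul_one]
          _ = _ := by ring

lemma ker_bound_int {d : ℕ} {f : Ed d → ℝ} (hf : IsKer f) : ∃ C : ℝ≥0∞, C ≠ ⊤ ∧
    ∀ s : ℝ, 0 < s → ∀ (x : Ed d) (g : Ed d → ℝ),
      ‖∫ y, g y * Ker f s x y‖ₑ ≤ C * Av s (fun y => ‖g y‖ₑ) x := by
  obtain ⟨C, hC, h⟩ := ker_bound hf
  refine ⟨C, hC, fun s hs x g => ?_⟩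
  refine (enorm_integral_le_lintegral_enorm _).trans ?_
  refine le_trans (le_of_eq ?_) (h s hs x _)
  refine lintegral_congr fun y => ?_
  rw [enorm_mul, mul_comm]

/-- The standard mollifier. -/
def psiBump (d : ℕ) : ContDiffBump (0 : Ed d) := ⟨1 / 4, 1 / 2, by norm_num, by norm_num⟩

/-- The standard mollifier. -/
def psi (d : ℕ) : Ed d → ℝ := (psiBump d).normed volume

lemma psi_isKer (d : ℕ) : IsKer (psi d) := by
  refine ⟨(psiBump d).contDiff_normed, ?_⟩
  unfold psi
  rw [ContDiffBump.tsupport_normed_eq]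
  exact closedBall_subset_ball (by norm_num [psiBump])

lemma psi_int {d : ℕ} {s : ℝ} (hs : 0 < s) (x : Ed d) : ∫ y, Ker (psi d) s x y = 1 := by
  unfold Ker
  rw [integral_const_mul]
  have h1 : ∫ y, psi d (s⁻¹ • (x - y)) = ∫ y, psi d (s⁻¹ • y) :=
    integral_sub_left_eq_self (fun y => psi d (s⁻¹ • y)) volume x
  rw [h1, Measure.integral_comp_smul]
  have : ∫ y, psi d y = 1 := (psiBump d).integral_normed
  rw [this]
  have hsd : 0 < s ^ d := by positivity
  simp [abs_of_pos hsd]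
  field_simp

lemma psi_nonneg {d : ℕ} (x : Ed d) : 0 ≤ psi d x := (psiBump d).nonneg_normed x

/-- Lebesgue points. -/
def LebPt {d : ℕ} (f : Ed d → ℝ) (x : Ed d) : Prop :=
  Tendsto (fun s => Av s (fun y => ‖f y - f x‖ₑ) x) (𝓝[>] (0:ℝ)) (𝓝 0)

lemma lebPt_of_integrable {d : ℕ} {f : Ed d → ℝ} (hf : Integrable f) :
    ∀ᵐ x, LebPt f x := by
  have := (IsUnifLocDoublingMeasure.vitaliFamily (volume : Measure (Ed d)) 1).ae_tendsto_lintegral_enorm_sub_div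
    hf.locallyIntegrable
  filter_upwards [this] with x hx
  have h2 : Tendsto (fun s : ℝ => closedBall x s) (𝓝[>] 0)
      ((IsUnifLocDoublingMeasure.vitaliFamily (volume : Measure (Ed d)) 1).filterAt x) := by
    apply IsUnifLocDoublingMeasure.tendsto_closedBall_filterAt volume (fun _ => x) (fun s => s) tendsto_id
    filter_upwards [self_mem_nhdsWithin] with s hs
    have hs : 0 < s := hs
    exact mem_closedBall_self (by linarith)
  have h3 := hx.comp h2
  refine tendsto_of_tendsto_of_tendsto_of_le_of_le' tendsto_const_nhds h3
    (Eventually.of_forall fun _ => zero_le) ?_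
  filter_upwards [self_mem_nhdsWithin] with s hs
  have hs : 0 < s := hs
  simp only [Function.comp, Av]
  rw [ENNReal.div_eq_inv_mul]
  have : volume (closedBall x s) = volume (ball (0 : Ed d) s) := by
    rw [Measure.addHaar_closedBall volume _ hs.le, Measure.addHaar_ball_of_pos volume _ hs]
  rw [this]
  refine mul_le_mul_right ?_ _
  exact lintegral_mono_set ball_subset_closedBall

lemma lebPt_congr {d : ℕ} {f g : Ed d → ℝ} {x : Ed d} {R : ℝ} (hR : 0 < R)
    (h : ∀ y ∈ ball x R, f y = g y) (hf : LebPt f x) : LebPt g x := by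
  unfold LebPt at *
  refine hf.congr' ?_
  filter_upwards [Ioo_mem_nhdsGT hR] with s hs
  unfold Av
  congr 1
  apply setLIntegral_congr_fun measurableSet_ball
  intro y hy
  simp only
  rw [h y (ball_subset_ball hs.2.le hy), h x (mem_ball_self hR)]

lemma lebPt_tendsto {d : ℕ} {f : Ed d → ℝ} {x : Ed d} (hf : LebPt f x) {R : ℝ} (hR : 0 < R)
    (hi : IntegrableOn f (ball x R)) :
    Tendsto (fun s => ∫ y, f y * Ker (psi d) s x y) (𝓝[>] 0) (𝓝 (f x)) := by
  obtain ⟨C, hC, h⟩ := ker_bound_int (psi_isKer d)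
  rw [tendsto_iff_edist_tendsto_0]
  have h0 : Tendsto (fun s => C * Av s (fun y => ‖f y - f x‖ₑ) x) (𝓝[>] (0:ℝ)) (𝓝 0) := by
    have := ENNReal.Tendsto.const_mul hf (Or.inr hC)
    simpa using this
  refine tendsto_of_tendsto_of_tendsto_of_le_of_le' tendsto_const_nhds h0
    (Eventually.of_forall fun _ => zero_le) ?_
  filter_upwards [Ioo_mem_nhdsGT hR] with s hs
  refine le_trans (le_of_eq ?_) (h s hs.1 x (fun y => f y - f x))
  rw [edist_eq_enorm_sub]
  congr 1
  have hK : Continuous (Ker (psi d) s x) := (ker_smth (psi_isKer d).1 s x).continuous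
  have hKc : HasCompactSupport (Ker (psi d) s x) :=
    (ker_test (psi_isKer d) hs.1 (subset_univ (closedBall x s))).2.1
  have hKi : Integrable (Ker (psi d) s x) := hK.integrable_of_hasCompactSupport hKc
  have hfi : Integrable (fun y => f y * Ker (psi d) s x y) := by
    have h1 : Integrable (fun y => (ball x R).indicator f y * Ker (psi d) s x y) := by
      obtain ⟨B, hB⟩ := hKc.exists_bound_of_continuous hK
      exact ((integrable_indicator_iff measurableSet_ball).2 hi).mul_bdd (c := B)
        hK.aestronglyMeasurable (Eventually.of_forall hB)
    refine h1.congr (Eventually.of_forall fun y => ?_)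
    by_cases hy : y ∈ ball x R
    · simp only [indicator_of_mem hy]
    · simp only
      rw [ker_zero (psi_isKer d) hs.1 (fun h' => hy (ball_subset_ball hs.2.le h'))]
      simp
  simp_rw [sub_mul]
  rw [integral_sub hfi (hKi.const_mul _), integral_const_mul, psi_int hs.1, mul_one]


/-- Abstract weights. -/
structure Wt {d : ℕ} (ρ : Ed d → ℝ) (Ω : Set (Ed d)) : Prop where
  lip : ∀ x y, |ρ x - ρ y| ≤ dist x y
  nonneg : ∀ x, 0 ≤ ρ x
  le_one : ∀ x, ρ x ≤ 1
  dom : ∀ x, x ∈ Ω ↔ 0 < ρ x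

lemma wt_cont {d : ℕ} {ρ : Ed d → ℝ} {Ω : Set (Ed d)} (W : Wt ρ Ω) : Continuous ρ := by
  have : LipschitzWith 1 ρ := by
    apply LipschitzWith.of_dist_le_mul
    intro x y
    rw [Real.dist_eq]
    simpa using W.lip x y
  exact this.continuous

lemma wt_open {d : ℕ} {ρ : Ed d → ℝ} {Ω : Set (Ed d)} (W : Wt ρ Ω) : IsOpen Ω := by
  have : Ω = {x | 0 < ρ x} := by ext x; exact W.dom x
  rw [this]
  exact isOpen_lt continuous_const (wt_cont W)

lemma wt_le {d : ℕ} {ρ : Ed d → ℝ} {Ω : Set (Ed d)} (W : Wt ρ Ω) {x y : Ed d}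
    (hy : y ∈ closedBall x (ρ x / 2)) : ρ x / 2 ≤ ρ y ∧ ρ y ≤ 2 * ρ x := by
  have h1 := abs_le.1 (W.lip y x)
  have h2 : dist y x ≤ ρ x / 2 := hy
  have := W.nonneg x
  constructor <;> linarith

lemma wt_sub {d : ℕ} {ρ : Ed d → ℝ} {Ω : Set (Ed d)} (W : Wt ρ Ω) {x : Ed d} (hx : x ∈ Ω) :
    closedBall x (ρ x / 2) ⊆ Ω := by
  intro y hy
  have h1 := (wt_le W hy).1
  have h2 := (W.dom x).1 hx
  exact (W.dom y).2 (by linarith)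

lemma av_mono {d : ℕ} {f g : Ed d → ℝ≥0∞} {r : ℝ} {x : Ed d}
    (h : ∀ᵐ y, y ∈ ball x r → f y ≤ g y) : Av r f x ≤ Av r g x := by
  unfold Av
  refine mul_le_mul_right ?_ _
  apply lintegral_mono_ae
  exact (ae_restrict_iff' measurableSet_ball).2 h

lemma av_const {d : ℕ} {r : ℝ} (hr : 0 < r) (c : ℝ≥0∞) (x : Ed d) :
    Av r (fun _ => c) x = c := by
  unfold Av
  rw [setLIntegral_const, vol_ball_eq r x, mul_comm c, ← mul_assoc, ENNReal.inv_mul_cancel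
    (vol_ball_ne_zero hr _) (vol_ball_ne_top _ _), one_mul]

lemma av_const_mul {d : ℕ} {r : ℝ} {c : ℝ≥0∞} (hc : c ≠ ⊤) (f : Ed d → ℝ≥0∞) (x : Ed d) :
    Av r (fun y => c * f y) x = c * Av r f x := by
  unfold Av
  rw [lintegral_const_mul' _ _ hc]
  ring

lemma av_const_add {d : ℕ} {r : ℝ} (hr : 0 < r) (c : ℝ≥0∞) (f : Ed d → ℝ≥0∞) (x : Ed d) :
    Av r (fun y => c + f y) x = c + Av r f x := by
  conv_rhs => rw [← av_const hr c x]
  unfold Av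
  rw [lintegral_add_left measurable_const, mul_add]

lemma lebPt_ae {d : ℕ} {ρ : Ed d → ℝ} {Ω : Set (Ed d)} (W : Wt ρ Ω) {f : Ed d → ℝ}
    (hf : LocallyIntegrableOn f Ω volume) : ∀ᵐ x, x ∈ Ω → LebPt f x := by
  have h : volume {x | x ∈ Ω ∧ ¬ LebPt f x} = 0 := by
    apply measure_null_of_locally_null
    intro x0 hx0
    have hρ := (W.dom x0).1 hx0.1
    have hi : IntegrableOn f (ball x0 (ρ x0 / 2)) :=
      (hf.integrableOn_compact_subset (wt_sub W hx0.1) (isCompact_closedBall _ _)).mono_set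
        ball_subset_closedBall
    refine ⟨{x | x ∈ Ω ∧ ¬ LebPt f x} ∩ ball x0 (ρ x0 / 2),
      inter_mem self_mem_nhdsWithin (mem_nhdsWithin_of_mem_nhds (ball_mem_nhds _ (by linarith))), ?_⟩
    have := lebPt_of_integrable ((integrable_indicator_iff measurableSet_ball).2 hi)
    rw [ae_iff] at this
    refine measure_mono_null ?_ this
    rintro x ⟨hx1, hx2⟩
    intro hL
    apply hx1.2
    obtain ⟨R, hR, hsub⟩ := Metric.isOpen_iff.1 isOpen_ball x hx2
    refine lebPt_congr hR ?_ hL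
    intro y hy
    exact indicator_of_mem (hsub hy) f
  rw [ae_iff]
  convert h using 2
  ext x
  simp

lemma test_setInt {d : ℕ} {Ω : Set (Ed d)} {φ : Ed d → ℝ} (hφ : IsTestFun d Ω φ) (v : Ed d → ℝ) :
    ∫ x in Ω, v x * φ x = ∫ x, v x * φ x := by
  apply setIntegral_eq_integral_of_forall_compl_eq_zero
  intro x hx
  rw [image_eq_zero_of_notMem_tsupport (fun h => hx (hφ.2.2 h)), mul_zero]

lemma weak_pair {d : ℕ} {Ω : Set (Ed d)} {α : Fin d → ℕ} {u v φ : Ed d → ℝ}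
    (h : HasWeakDerivOn d Ω α u v) (hφ : IsTestFun d Ω φ) :
    ∫ x, u x * pderivA d α φ x = (-1 : ℝ) ^ (∑ i, α i) * ∫ x, v x * φ x := by
  have := h.2.2 φ hφ
  rwa [test_setInt hφ, test_setInt (test_pderivA α hφ)] at this

lemma weak_step {d : ℕ} {Ω : Set (Ed d)} {α : Fin d → ℕ} {i : Fin d} {u f fi φ : Ed d → ℝ}
    (h : HasWeakDerivOn d Ω α u f) (hi : HasWeakDerivOn d Ω (α + ee i) u fi)
    (hφ : IsTestFun d Ω φ) :
    ∫ x, f x * pderivI d i φ x = - ∫ x, fi x * φ x := by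
  have h1 := weak_pair h (test_pderivI hφ i)
  have h2 := weak_pair hi hφ
  rw [pderivA_succ α i hφ.1, h1, sum_add_single, pow_succ] at h2
  have h3 : (-1 : ℝ) ^ (∑ i, α i) ≠ 0 := by positivity
  apply mul_left_cancel₀ h3
  rw [h2]; ring

lemma pderivA_ker {d : ℕ} (α : Fin d → ℕ) {f : Ed d → ℝ} (hf : Smth f) (s : ℝ) (x y : Ed d) :
    pderivA d α (Ker f s x) y = (-s⁻¹) ^ (∑ i, α i) * Ker (pderivA d α f) s x y := by
  have := congrFun (pderivA_scale α s⁻¹ x hf (s ^ d)⁻¹) y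
  unfold Ker
  rw [this]; ring

lemma pderivI_ker {d : ℕ} (i : Fin d) {f : Ed d → ℝ} (hf : Smth f) (s : ℝ) (x y : Ed d) :
    pderivI d i (Ker f s x) y = (-s⁻¹) * Ker (pderivI d i f) s x y := by
  have := congrFun (pderivI_scale hf (s ^ d)⁻¹ s⁻¹ x i) y
  unfold Ker
  rw [this]; ring

/-- Bound for the mollification of a weak derivative. -/
lemma moll_bound (d : ℕ) (α : Fin d → ℕ) : ∃ C : ℝ≥0∞, C ≠ ⊤ ∧ ∀ (Ω : Set (Ed d)) (u f : Ed d → ℝ),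
    HasWeakDerivOn d Ω α u f → ∀ (x : Ed d) (r : ℝ), 0 < r → closedBall x r ⊆ Ω →
    ‖∫ y, f y * Ker (psi d) r x y‖ₑ ≤ C * (ENNReal.ofReal r⁻¹ ^ (∑ i, α i) * eLpNorm u ⊤ volume) := by
  obtain ⟨C, hC, h⟩ := ker_bound_int (isKer_pderivA (psi_isKer d) α)
  refine ⟨C, hC, fun Ω u f hw x r hr hΩ => ?_⟩
  have h1 := weak_pair hw (ker_test (psi_isKer d) hr hΩ)
  have h2 : ‖∫ y, f y * Ker (psi d) r x y‖ₑ = ‖∫ y, u y * pderivA d α (Ker (psi d) r x) y‖ₑ := by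
    rw [h1, enorm_mul]
    simp
  rw [h2]
  have h3 : ∫ y, u y * pderivA d α (Ker (psi d) r x) y =
      (-r⁻¹) ^ (∑ i, α i) * ∫ y, u y * Ker (pderivA d α (psi d)) r x y := by
    rw [← integral_const_mul]
    congr 1
    ext y
    rw [pderivA_ker α (psi_isKer d).1]
    ring
  rw [h3, enorm_mul, enorm_pow, enorm_neg, Real.enorm_of_nonneg (by positivity)]
  calc _ ≤ ENNReal.ofReal r⁻¹ ^ (∑ i, α i) * (C * eLpNorm u ⊤ volume) := by
        refine mul_le_mul_right ((h r hr x u).trans (mul_le_mul_right ?_ _)) _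
        rw [← av_const hr (eLpNorm u ⊤ volume) x]
        apply av_mono
        have := ae_le_eLpNormEssSup (f := u) (μ := volume)
        filter_upwards [this] with y hy _
        simpa [eLpNorm_exponent_top] using hy
    _ = _ := by ring


/-- The kernels `w_i ψ(w)`. -/
def chi (d : ℕ) (i : Fin d) : Ed d → ℝ := fun w => w i * psi d w

lemma chi_isKer (d : ℕ) (i : Fin d) : IsKer (chi d i) := by
  refine ⟨?_, ?_⟩
  · have : ContDiff ℝ (⊤ : ℕ∞) (fun w : Ed d => w i) :=
      (EuclideanSpace.proj (𝕜 := ℝ) i : Ed d →L[ℝ] ℝ).contDiff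
    exact this.mul (psi_isKer d).1
  · refine (closure_mono ?_).trans (psi_isKer d).2
    exact Function.support_mul_subset_right _ _

lemma chi_pderivI (d : ℕ) (i : Fin d) (w : Ed d) :
    pderivI d i (chi d i) w = psi d w + w i * pderivI d i (psi d) w := by
  unfold pderivI
  have h1 : HasFDerivAt (fun w : Ed d => w i) (EuclideanSpace.proj (𝕜 := ℝ) i : Ed d →L[ℝ] ℝ) w :=
    (EuclideanSpace.proj (𝕜 := ℝ) i : Ed d →L[ℝ] ℝ).hasFDerivAt
  have h2 := (smth_differentiable (psi_isKer d).1 w).hasFDerivAt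
  have h3 := (h1.mul h2).fderiv
  have : chi d i = (fun w : Ed d => w i) * psi d := rfl
  rw [this, h3]
  simp
  ring

lemma chi_sum (d : ℕ) (w : Ed d) :
    ∑ i, pderivI d i (chi d i) w = d * psi d w + fderiv ℝ (psi d) w w := by
  simp only [chi_pderivI, Finset.sum_add_distrib]
  congr 1
  · simp
  · unfold pderivI
    have : w = ∑ i, w i • (EuclideanSpace.single i (1:ℝ) : Ed d) := by
      ext j
      simp [Finset.sum_apply, Pi.single_apply]
    conv_rhs => rw [this]
    rw [map_sum]
    simp only [map_smul, smul_eq_mul]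
    rw [← this]

lemma ker_deriv {d : ℕ} {s : ℝ} (hs : 0 < s) (x y : Ed d) :
    HasDerivAt (fun s => Ker (psi d) s x y) (∑ i, pderivI d i (Ker (chi d i) s x) y) s := by
  have e : ∑ i, pderivI d i (Ker (chi d i) s x) y =
      -((d : ℝ) * s ^ (d - 1)) / (s ^ d) ^ 2 * psi d (s⁻¹ • (x - y)) +
      (s ^ d)⁻¹ * (fderiv ℝ (psi d) (s⁻¹ • (x - y))) ((-(s ^ 2)⁻¹) • (x - y)) := by
    simp only [pderivI_ker _ (chi_isKer d _).1]
    unfold Ker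
    rw [← Finset.mul_sum, ← Finset.mul_sum, chi_sum]
    simp only [map_smul, smul_eq_mul]
    rcases d with _ | d
    · simp; ring
    · simp only [Nat.add_sub_cancel]
      field_simp
      ring
  rw [e]
  have h1 : HasDerivAt (fun s : ℝ => s⁻¹ • (x - y)) ((-(s ^ 2)⁻¹) • (x - y)) s :=
    (hasDerivAt_inv hs.ne').smul_const (x - y)
  have h2 := (smth_differentiable (psi_isKer d).1 (s⁻¹ • (x - y))).hasFDerivAt.comp_hasDerivAt s h1
  have h3 := (hasDerivAt_pow d s).inv (by positivity)
  exact h3.mul h2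

lemma ker_abs {d : ℕ} {f : Ed d → ℝ} {B : ℝ} (hB : ∀ z, |f z| ≤ B) {s t : ℝ} (ht : 0 < t)
    (hts : t ≤ s) (x y : Ed d) : |Ker f s x y| ≤ (t ^ d)⁻¹ * B := by
  unfold Ker
  have hs : 0 < s := ht.trans_le hts
  rw [abs_mul, abs_of_pos (by positivity : 0 < (s ^ d)⁻¹)]
  have : 0 ≤ B := (abs_nonneg _).trans (hB 0)
  have h1 : (s ^ d)⁻¹ ≤ (t ^ d)⁻¹ := by gcongr
  exact mul_le_mul h1 (hB _) (abs_nonneg _) (by positivity)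

lemma ker_setInt {d : ℕ} {k : Ed d → ℝ} (hk : IsKer k) {s R : ℝ} (hs : 0 < s) (hR : s ≤ R)
    (x : Ed d) (f : Ed d → ℝ) :
    ∫ y in ball x R, f y * Ker k s x y = ∫ y, f y * Ker k s x y := by
  apply setIntegral_eq_integral_of_forall_compl_eq_zero
  intro y hy
  rw [ker_zero hk hs (fun h => hy (ball_subset_ball hR h)), mul_zero]

lemma ker_integrableOn {d : ℕ} {k : Ed d → ℝ} (hk : Continuous k) {B : ℝ} (hB : ∀ z, |k z| ≤ B)
    {s : ℝ} (x : Ed d) {f : Ed d → ℝ} {S : Set (Ed d)} (hs : 0 < s)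
    (hf : IntegrableOn f S) : IntegrableOn (fun y => f y * Ker k s x y) S := by
  refine Integrable.mul_bdd (c := (s ^ d)⁻¹ * B) hf ?_ ?_
  · apply Continuous.aestronglyMeasurable
    unfold Ker
    fun_prop
  · exact Eventually.of_forall fun y => ker_abs hB hs le_rfl x y

lemma moll_deriv {d : ℕ} {x : Ed d} {R s : ℝ} (hs : 0 < s) (hsR : s < R) {f : Ed d → ℝ}
    (hf : IntegrableOn f (ball x R)) :
    HasDerivAt (fun s => ∫ y, f y * Ker (psi d) s x y)
      (∑ i, ∫ y, f y * pderivI d i (Ker (chi d i) s x) y) s := by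
  obtain ⟨B0, hB0, hB⟩ := isKer_bdd (psi_isKer d)
  have hex := fun i => isKer_bdd (isKer_pderivI (chi_isKer d i) i)
  choose E hE0 hE using hex
  have hcont : Continuous (psi d) := (psi_isKer d).1.continuous
  have hc : ∀ i, Continuous (pderivI d i (chi d i)) :=
    fun i => (isKer_pderivI (chi_isKer d i) i).1.continuous
  have key := hasDerivAt_integral_of_dominated_loc_of_deriv_le (μ := volume.restrict (ball x R))
    (F := fun s y => f y * Ker (psi d) s x y)
    (F' := fun s y => f y * ∑ i, pderivI d i (Ker (chi d i) s x) y) (x₀ := s)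
    (s := ball s (s / 2))
    (bound := fun y => |f y| * ∑ i, (s / 2)⁻¹ * (((s / 2) ^ d)⁻¹ * E i))
    (ball_mem_nhds _ (by linarith)) ?_ ?_ ?_ ?_ ?_ ?_
  · have h1 := key.2
    have e : ∫ y in ball x R, f y * ∑ i, pderivI d i (Ker (chi d i) s x) y =
        ∑ i, ∫ y, f y * pderivI d i (Ker (chi d i) s x) y := by
      simp only [Finset.mul_sum, pderivI_ker _ (chi_isKer d _).1]
      rw [integral_finsetSum]
      · refine Finset.sum_congr rfl fun i _ => ?_
        simp only [mul_left_comm (f _), integral_const_mul]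
        rw [ker_setInt (isKer_pderivI (chi_isKer d i) i) hs hsR.le]
      · intro i _
        simp only [mul_left_comm (f _)]
        exact (ker_integrableOn (hc i) (hE i) x hs hf).const_mul _
    rw [e] at h1
    refine h1.congr_of_eventuallyEq ?_
    filter_upwards [Ioo_mem_nhds hs hsR] with t ht
    exact (ker_setInt (psi_isKer d) ht.1 ht.2.le x f).symm
  · filter_upwards [Ioi_mem_nhds hs] with t ht
    exact (ker_integrableOn hcont hB x ht hf).aestronglyMeasurable
  · exact ker_integrableOn hcont hB x hs hf
  · refine hf.aestronglyMeasurable.mul ?_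
    apply Continuous.aestronglyMeasurable
    simp only [pderivI_ker _ (chi_isKer d _).1]
    unfold Ker
    fun_prop
  · refine Eventually.of_forall fun y t ht => ?_
    have ht' : s / 2 ≤ t := by
      rw [mem_ball, Real.dist_eq] at ht
      have := abs_lt.1 ht
      linarith
    have ht0 : 0 < t := by linarith
    rw [norm_mul, Real.norm_eq_abs]
    refine mul_le_mul_of_nonneg_left ?_ (abs_nonneg _)
    refine (norm_sum_le _ _).trans (Finset.sum_le_sum fun i _ => ?_)
    rw [pderivI_ker _ (chi_isKer d _).1, norm_mul, Real.norm_eq_abs, Real.norm_eq_abs, abs_neg,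
      abs_of_pos (by positivity : 0 < t⁻¹)]
    have h1 : t⁻¹ ≤ (s / 2)⁻¹ := by gcongr
    exact mul_le_mul h1 (ker_abs (hE i) (by linarith) ht' x y) (abs_nonneg _) (by positivity)
  · exact hf.abs.mul_const _
  · refine Eventually.of_forall fun y t ht => ?_
    have ht0 : 0 < t := by
      rw [mem_ball, Real.dist_eq] at ht
      have := abs_lt.1 ht
      linarith
    exact (ker_deriv ht0 x y).const_mul (f y)

/-- One-step inequality. -/
lemma one_step (d : ℕ) (α : Fin d → ℕ) : ∃ C : ℝ≥0∞, C ≠ ⊤ ∧ ∀ (Ω : Set (Ed d)) (u f : Ed d → ℝ)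
    (g : Fin d → Ed d → ℝ), HasWeakDerivOn d Ω α u f →
    (∀ i, HasWeakDerivOn d Ω (α + ee i) u (g i)) → ∀ (x : Ed d) (R r : ℝ), 0 < r → r < R →
    closedBall x R ⊆ Ω → LebPt f x → ∀ S : ℝ≥0∞,
    (∀ i, ∀ s ∈ Ioo 0 R, Av s (fun y => ‖g i y‖ₑ) x ≤ S) →
    ‖f x‖ₑ ≤ C * (ENNReal.ofReal r⁻¹ ^ (∑ i, α i) * eLpNorm u ⊤ volume + ENNReal.ofReal r * S) := by
  obtain ⟨C0, hC0, h0⟩ := moll_bound d α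
  have hex := fun i => ker_bound_int (chi_isKer d i)
  choose E hE hE' using hex
  have hsum : ∑ i, E i ≠ ⊤ := by simpa [ENNReal.sum_eq_top] using hE
  refine ⟨C0 + ∑ i, E i, by simp [hC0, hE], ?_⟩
  intro Ω u f g hf hg x R r hr hrR hΩ hL S hS
  have hfi : IntegrableOn f (ball x R) :=
    (hf.2.1.integrableOn_compact_subset hΩ (isCompact_closedBall _ _)).mono_set
        ball_subset_closedBall
  set P : ℝ → ℝ := fun s => ∫ y, f y * Ker (psi d) s x y with hP
  have hlim : Tendsto P (𝓝[>] 0) (𝓝 (f x)) := lebPt_tendsto hL (hr.trans hrR) hfi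
  have hd : ∀ s ∈ Ioo 0 R, HasDerivAt P (∑ i, - ∫ y, g i y * Ker (chi d i) s x y) s := by
    intro s hs
    have := moll_deriv hs.1 hs.2 hfi
    convert this using 2 with i
    exact (weak_step hf (hg i) (ker_test (chi_isKer d i) hs.1
      ((closedBall_subset_closedBall hs.2.le).trans hΩ))).symm
  have hbd : ∀ s ∈ Ioo 0 R, ‖∑ i, - ∫ y, g i y * Ker (chi d i) s x y‖ₑ ≤ (∑ i, E i) * S := by
    intro s hs
    refine (enorm_sum_le _ _).trans ?_
    rw [Finset.sum_mul]
    refine Finset.sum_le_sum fun i _ => ?_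
    rw [enorm_neg]
    exact (hE' i s hs.1 x (g i)).trans (mul_le_mul_right (hS i s hs) _)
  have hdiff : ∀ s ∈ Ioo 0 r, ‖P s - P r‖ₑ ≤ ENNReal.ofReal r * ((∑ i, E i) * S) := by
    intro s hs
    by_cases htop : (∑ i, E i) * S = ⊤
    · rw [htop, ENNReal.mul_top (by simpa using hr)]; exact le_top
    have hreal := Convex.norm_image_sub_le_of_norm_hasDerivWithin_le (f := P)
      (C := ((∑ i, E i) * S).toReal) (s := Ioo 0 R) (x := r) (y := s)
      (fun t ht => (hd t ht).hasDerivWithinAt) (fun t ht => by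
        rw [← toReal_enorm]
        exact ENNReal.toReal_mono htop (hbd t ht)) (convex_Ioo 0 R) ⟨hr, hrR⟩
        ⟨hs.1, hs.2.trans hrR⟩
    have h2 : ‖s - r‖ ≤ r := by
      rw [Real.norm_eq_abs, abs_le]; constructor <;> linarith [hs.1, hs.2]
    have h3 := hreal.trans (mul_le_mul_of_nonneg_left h2 ENNReal.toReal_nonneg)
    rw [← ofReal_norm]
    refine (ENNReal.ofReal_le_ofReal h3).trans ?_
    rw [ENNReal.ofReal_mul ENNReal.toReal_nonneg, ENNReal.ofReal_toReal htop, mul_comm]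
  have hfin : ‖f x - P r‖ₑ ≤ ENNReal.ofReal r * ((∑ i, E i) * S) := by
    have h1 : Tendsto (fun s => ‖P s - P r‖ₑ) (𝓝[>] 0) (𝓝 ‖f x - P r‖ₑ) :=
      (hlim.sub_const _).enorm
    refine le_of_tendsto h1 ?_
    filter_upwards [Ioo_mem_nhdsGT hr] with s hs
    exact hdiff s hs
  have hPr := h0 Ω u f hf x r hr ((closedBall_subset_closedBall hrR.le).trans hΩ)
  calc ‖f x‖ₑ = ‖P r + (f x - P r)‖ₑ := by congr 1; ring
    _ ≤ ‖P r‖ₑ + ‖f x - P r‖ₑ := enorm_add_le _ _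
    _ ≤ C0 * (ENNReal.ofReal r⁻¹ ^ (∑ i, α i) * eLpNorm u ⊤ volume) +
        ENNReal.ofReal r * ((∑ i, E i) * S) := add_le_add hPr hfin
    _ = C0 * (ENNReal.ofReal r⁻¹ ^ (∑ i, α i) * eLpNorm u ⊤ volume) +
        (∑ i, E i) * (ENNReal.ofReal r * S) := by ring
    _ ≤ _ := by
      rw [mul_add]
      exact add_le_add (mul_le_mul_left (le_self_add) _) (mul_le_mul_left (le_add_self) _)


/-- Local maximal operator. -/
def LL {d : ℕ} (ρ : Ed d → ℝ) (f : Ed d → ℝ≥0∞) (x : Ed d) : ℝ≥0∞ :=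
  ⨆ s : Ioo (0 : ℝ) (ρ x / 2), Av (s : ℝ) f x

lemma av_le_LL' {d : ℕ} {ρ : Ed d → ℝ} {f : Ed d → ℝ≥0∞} {x : Ed d} {s : ℝ}
    (hs : s ∈ Ioo 0 (ρ x / 2)) : Av s f x ≤ LL ρ f x :=
  le_iSup (fun s : Ioo (0 : ℝ) (ρ x / 2) => Av (s : ℝ) f x) ⟨s, hs⟩

lemma LL_affine {d : ℕ} {ρ : Ed d → ℝ} {Ω : Set (Ed d)} (W : Wt ρ Ω) {f g : Ed d → ℝ≥0∞}
    {c b : ℝ≥0∞} (hb : b ≠ ⊤) (h : ∀ᵐ y, y ∈ Ω → f y ≤ c + b * g y) {x : Ed d} (hx : x ∈ Ω) :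
    LL ρ f x ≤ c + b * LL ρ g x := by
  refine iSup_le fun s => ?_
  have h1 : Av (s : ℝ) f x ≤ Av (s : ℝ) (fun y => c + b * g y) x := by
    apply av_mono
    filter_upwards [h] with y hy hyb
    exact hy (wt_sub W hx (ball_subset_closedBall (ball_subset_ball s.2.2.le hyb)))
  rw [av_const_add s.2.1, av_const_mul hb] at h1
  exact h1.trans (add_le_add le_rfl (mul_le_mul_right (av_le_LL' s.2) _))

lemma LL_iter {d : ℕ} {ρ : Ed d → ℝ} {Ω : Set (Ed d)} (W : Wt ρ Ω) {f g : Ed d → ℝ≥0∞}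
    {c b : ℝ≥0∞} (hb : b ≠ ⊤) (h : ∀ᵐ y, y ∈ Ω → f y ≤ c + b * g y) (k : ℕ) :
    ∀ x ∈ Ω, (LL ρ)^[k + 1] f x ≤ c + b * (LL ρ)^[k + 1] g x := by
  induction k with
  | zero => intro x hx; simpa using LL_affine W hb h hx
  | succ k ih =>
    intro x hx
    rw [Function.iterate_succ_apply', Function.iterate_succ_apply' (LL ρ) (k + 1) g]
    exact LL_affine W hb (Eventually.of_forall ih) hx

lemma LL_weight {d : ℕ} {ρ : Ed d → ℝ} {Ω : Set (Ed d)} (W : Wt ρ Ω) {f w : Ed d → ℝ≥0∞}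
    (a : ℝ) {c : ℝ≥0∞} (hc : c ≠ ⊤)
    (h : ∀ᵐ y, y ∈ Ω → f y ≤ c * (ENNReal.ofReal (ρ y ^ a) * w y)) {x : Ed d} (hx : x ∈ Ω) :
    LL ρ f x ≤ (c * ENNReal.ofReal (2 ^ |a|)) * (ENNReal.ofReal (ρ x ^ a) * MM w x) := by
  refine iSup_le fun s => ?_
  have hρ := (W.dom x).1 hx
  have h1 : Av (s : ℝ) f x ≤
      Av (s : ℝ) (fun y => (c * ENNReal.ofReal (2 ^ |a|) * ENNReal.ofReal (ρ x ^ a)) * w y) x := by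
    apply av_mono
    filter_upwards [h] with y hy hyb
    have hyb' := ball_subset_closedBall (ball_subset_ball s.2.2.le hyb)
    refine (hy (wt_sub W hx hyb')).trans ?_
    rw [← mul_assoc]
    refine mul_le_mul_left ?_ _
    rw [mul_assoc]
    refine mul_le_mul_right ?_ _
    rw [← ENNReal.ofReal_mul (by positivity)]
    refine ENNReal.ofReal_le_ofReal ?_
    obtain ⟨h2, h3⟩ := wt_le W hyb'
    have hy0 : 0 < ρ y := by linarith
    have e : ρ y ^ a = (ρ y / ρ x) ^ a * ρ x ^ a := by
      rw [Real.div_rpow hy0.le hρ.le, div_mul_cancel₀]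
      positivity
    rw [e]
    refine mul_le_mul_of_nonneg_right ?_ (by positivity)
    rcases le_or_gt 0 a with ha | ha
    · rw [abs_of_nonneg ha]
      refine Real.rpow_le_rpow (by positivity) ?_ ha
      rw [div_le_iff₀ hρ]; exact h3
    · rw [abs_of_neg ha, Real.rpow_neg (by norm_num), ← Real.inv_rpow (by norm_num)]
      refine Real.rpow_le_rpow_of_nonpos (by norm_num) ?_ ha.le
      rw [le_div_iff₀ hρ]; linarith
  rw [av_const_mul (by simp [ENNReal.mul_eq_top, hc])] at h1
  refine h1.trans ?_
  rw [mul_assoc]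
  refine mul_le_mul_right (mul_le_mul_right ?_ _) _
  have : (s : ℝ) < 1 := by have := s.2.2; have := W.le_one x; linarith
  exact le_iSup (fun r : Ioo (0:ℝ) 1 => Av (r : ℝ) w x) ⟨s, s.2.1, this⟩

lemma LL_weight_iter {d : ℕ} {ρ : Ed d → ℝ} {Ω : Set (Ed d)} (W : Wt ρ Ω) {f w : Ed d → ℝ≥0∞}
    (a : ℝ) (h : ∀ᵐ y, y ∈ Ω → f y ≤ ENNReal.ofReal (ρ y ^ a) * w y) (k : ℕ) :
    ∀ x ∈ Ω, (LL ρ)^[k + 1] f x ≤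
      ENNReal.ofReal (2 ^ |a|) ^ (k + 1) * (ENNReal.ofReal (ρ x ^ a) * MM^[k + 1] w x) := by
  induction k with
  | zero =>
    intro x hx
    have := LL_weight W (c := 1) a (by simp) (by simpa using h) hx
    simpa using this
  | succ k ih =>
    intro x hx
    rw [Function.iterate_succ_apply', Function.iterate_succ_apply' MM (k + 1) w]
    have := LL_weight W a (by simp) (Eventually.of_forall ih) hx
    rwa [← pow_succ] at this

/-- The sum of the weighted derivatives of order `j`. -/
def GG {d : ℕ} (ρ : Ed d → ℝ) (m : ℕ) (D : (Fin d → ℕ) → Ed d → ℝ) (j : ℕ) (x : Ed d) : ℝ≥0∞ :=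
  ∑ α ∈ (multiIdx d m).filter (fun α => ∑ i, α i = j), ENNReal.ofReal (ρ x ^ j) * ‖D α x‖ₑ

lemma av_le_LL {d : ℕ} {ρ : Ed d → ℝ} {Ω : Set (Ed d)} (W : Wt ρ Ω) {m : ℕ}
    (D : (Fin d → ℕ) → Ed d → ℝ) {α : Fin d → ℕ} (hα : α ∈ multiIdx d m) {x : Ed d} {s : ℝ}
    (hs : s ∈ Ioo 0 (ρ x / 2)) :
    ENNReal.ofReal (ρ x ^ (∑ i, α i)) * Av s (fun y => ‖D α y‖ₑ) x ≤
      2 ^ (∑ i, α i) * LL ρ (GG ρ m D (∑ i, α i)) x := by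
  set j := ∑ i, α i with hj
  rw [← av_const_mul (by simp)]
  have : Av s (fun y => ENNReal.ofReal (ρ x ^ j) * ‖D α y‖ₑ) x ≤
      Av s (fun y => 2 ^ j * GG ρ m D j y) x := by
    apply av_mono
    refine Eventually.of_forall fun y hy => ?_
    have hyb' := ball_subset_closedBall (ball_subset_ball hs.2.le hy)
    obtain ⟨h2, h3⟩ := wt_le W hyb'
    have h4 : ENNReal.ofReal (ρ y ^ j) * ‖D α y‖ₑ ≤ GG ρ m D j y := by
      unfold GG
      exact Finset.single_le_sum (f := fun α => ENNReal.ofReal (ρ y ^ j) * ‖D α y‖ₑ)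
        (fun _ _ => zero_le) (Finset.mem_filter.2 ⟨hα, hj.symm⟩)
    refine le_trans ?_ (mul_le_mul_right h4 _)
    rw [← mul_assoc]
    refine mul_le_mul_left ?_ _
    have e : (2 : ℝ≥0∞) ^ j = ENNReal.ofReal (2 ^ j) := by
      rw [ENNReal.ofReal_pow (by norm_num)]; simp
    rw [e, ← ENNReal.ofReal_mul (by positivity), ← mul_pow]
    refine ENNReal.ofReal_le_ofReal ?_
    have := W.nonneg x
    gcongr
    linarith
  refine this.trans ?_
  rw [av_const_mul (by simp)]
  exact mul_le_mul_right (av_le_LL' hs) _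

lemma lebPt_enorm_le {d : ℕ} {f : Ed d → ℝ} {x : Ed d} (hf : LebPt f x) {R : ℝ} (hR : 0 < R)
    (hi : IntegrableOn f (ball x R)) {S : ℝ≥0∞}
    (hS : ∀ s ∈ Ioo 0 R, Av s (fun y => ‖f y‖ₑ) x ≤ S) : ‖f x‖ₑ ≤ S := by
  have h1 : ∀ s ∈ Ioo 0 R, ‖f x‖ₑ ≤ S + Av s (fun y => ‖f y - f x‖ₑ) x := by
    intro s hs
    have e : Av s (fun y => ‖f y‖ₑ + ‖f y - f x‖ₑ) x =
        Av s (fun y => ‖f y‖ₑ) x + Av s (fun y => ‖f y - f x‖ₑ) x := by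
      unfold Av
      rw [lintegral_add_left', mul_add]
      exact (hi.mono_set (ball_subset_ball hs.2.le)).aestronglyMeasurable.enorm
    calc ‖f x‖ₑ = Av s (fun _ => ‖f x‖ₑ) x := (av_const hs.1 _ _).symm
      _ ≤ Av s (fun y => ‖f y‖ₑ + ‖f y - f x‖ₑ) x := by
        apply av_mono
        refine Eventually.of_forall fun y _ => ?_
        calc ‖f x‖ₑ = ‖f y - (f y - f x)‖ₑ := by congr 1; ring
          _ ≤ _ := enorm_sub_le
      _ ≤ _ := by rw [e]; exact add_le_add (hS s hs) le_rfl
  have h2 : Tendsto (fun s => S + Av s (fun y => ‖f y - f x‖ₑ) x) (𝓝[>] 0) (𝓝 (S + 0)) :=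
    tendsto_const_nhds.add hf
  rw [add_zero] at h2
  refine ge_of_tendsto h2 ?_
  filter_upwards [Ioo_mem_nhdsGT hR] with s hs
  exact h1 s hs

lemma deriv_le_LL {d : ℕ} {ρ : Ed d → ℝ} {Ω : Set (Ed d)} (W : Wt ρ Ω) {m : ℕ}
    {D : (Fin d → ℕ) → Ed d → ℝ} {α : Fin d → ℕ} (hα : α ∈ multiIdx d m) {x : Ed d} (hx : x ∈ Ω)
    (hD : LocallyIntegrableOn (D α) Ω volume) (hL : LebPt (D α) x) :
    ENNReal.ofReal (ρ x ^ (∑ i, α i)) * ‖D α x‖ₑ ≤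
      2 ^ (∑ i, α i) * LL ρ (GG ρ m D (∑ i, α i)) x := by
  have hρ := (W.dom x).1 hx
  have h0 : ENNReal.ofReal (ρ x ^ (∑ i, α i)) ≠ 0 := by
    rw [Ne, ENNReal.ofReal_eq_zero, not_le]; positivity
  have := lebPt_enorm_le hL (R := ρ x / 2) (by linarith)
    ((hD.integrableOn_compact_subset (wt_sub W hx) (isCompact_closedBall _ _)).mono_set
      ball_subset_closedBall)
    (S := (2 ^ (∑ i, α i) * LL ρ (GG ρ m D (∑ i, α i)) x) / ENNReal.ofReal (ρ x ^ (∑ i, α i)))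
    (fun s hs => by
      rw [ENNReal.le_div_iff_mul_le (Or.inl h0) (Or.inl (by simp)), mul_comm]
      exact av_le_LL W D hα hs)
  rwa [ENNReal.le_div_iff_mul_le (Or.inl h0) (Or.inl (by simp)), mul_comm] at this


lemma ofReal_pow_mul_cancel {r t : ℝ} (hr : 0 < r) (ht : 0 < t) (j : ℕ) :
    ENNReal.ofReal (r ^ j) * ENNReal.ofReal (t * r)⁻¹ ^ j = ENNReal.ofReal t⁻¹ ^ j := by
  rw [← ENNReal.ofReal_pow (by positivity), ← ENNReal.ofReal_pow (by positivity),
    ← ENNReal.ofReal_mul (by positivity)]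
  congr 1
  rw [← mul_pow]
  congr 1
  field_simp

lemma one_step_G (d m : ℕ) : ∃ C : ℝ≥0∞, C ≠ ⊤ ∧ ∀ (Ω : Set (Ed d)) (ρ : Ed d → ℝ) (_ : Wt ρ Ω)
    (u : Ed d → ℝ) (D : (Fin d → ℕ) → Ed d → ℝ), IsWeakDerivFamily d Ω m u D →
    ∀ j < m, ∀ t ∈ Ioo (0 : ℝ) (1 / 2), ∀ᵐ x, x ∈ Ω → GG ρ m D j x ≤
      C * (ENNReal.ofReal t⁻¹ ^ j * eLpNorm u ⊤ volume + ENNReal.ofReal t * LL ρ (GG ρ m D (j + 1)) x) := by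
  choose E hE h using one_step d
  refine ⟨∑ α ∈ multiIdx d m, E α * 2 ^ (m + 1), ?_, ?_⟩
  · simp [ENNReal.sum_eq_top, ENNReal.mul_eq_top, hE]
  intro Ω ρ W u D hD j hj t ht
  have hleb : ∀ᵐ x, ∀ α ∈ multiIdx d m, x ∈ Ω → LebPt (D α) x := by
    rw [eventually_all_finset]
    intro α hα
    exact lebPt_ae W (hD α hα).2.1
  filter_upwards [hleb] with x hx hxΩ
  have hρ := (W.dom x).1 hxΩ
  set U := eLpNorm u ⊤ volume
  set L := LL ρ (GG ρ m D (j + 1)) x with hLdef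
  rw [Finset.sum_mul]
  unfold GG
  refine (Finset.sum_le_sum (fun α hα => ?_)).trans
    (Finset.sum_le_sum_of_subset (Finset.filter_subset _ _))
  obtain ⟨hα, hαj⟩ := Finset.mem_filter.1 hα
  have hαi : ∀ i, α + ee i ∈ multiIdx d m := by
    intro i
    rw [mem_multiIdx, sum_add_single]; omega
  have h0 : ENNReal.ofReal (ρ x ^ (j + 1)) ≠ 0 := by
    rw [Ne, ENNReal.ofReal_eq_zero, not_le]; positivity
  have key := h α Ω u (D α) (fun i => D (α + ee i)) (hD α hα) (fun i => hD _ (hαi i)) x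
    (ρ x / 2) (t * ρ x) (mul_pos ht.1 hρ) (by have := ht.2; nlinarith) (wt_sub W hxΩ) (hx α hα hxΩ)
    ((2 ^ (j + 1) * L) / ENNReal.ofReal (ρ x ^ (j + 1))) (fun i s hs => by
      rw [ENNReal.le_div_iff_mul_le (Or.inl h0) (Or.inl (by simp)), mul_comm]
      have := av_le_LL W D (hαi i) hs
      rwa [sum_add_single, hαj] at this)
  rw [hαj] at key
  refine (mul_le_mul_right key _).trans ?_
  have e1 := ofReal_pow_mul_cancel hρ ht.1 j
  have e2 : ENNReal.ofReal (ρ x ^ j) * (ENNReal.ofReal (t * ρ x) *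
      ((2 ^ (j + 1) * L) / ENNReal.ofReal (ρ x ^ (j + 1)))) = ENNReal.ofReal t * (2 ^ (j + 1) * L) := by
    have : ENNReal.ofReal (ρ x ^ j) * ENNReal.ofReal (t * ρ x) =
        ENNReal.ofReal t * ENNReal.ofReal (ρ x ^ (j + 1)) := by
      rw [← ENNReal.ofReal_mul (by positivity), ← ENNReal.ofReal_mul ht.1.le]
      congr 1; ring
    rw [← mul_assoc, this, mul_assoc, ENNReal.mul_div_cancel h0 (by simp)]
  calc _ = E α * ((ENNReal.ofReal (ρ x ^ j) * ENNReal.ofReal (t * ρ x)⁻¹ ^ j) * U +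
        ENNReal.ofReal (ρ x ^ j) * (ENNReal.ofReal (t * ρ x) *
          ((2 ^ (j + 1) * L) / ENNReal.ofReal (ρ x ^ (j + 1))))) := by ring
    _ = E α * (1 * (ENNReal.ofReal t⁻¹ ^ j * U) + 2 ^ (j + 1) * (ENNReal.ofReal t * L)) := by
      rw [e1, e2]; ring
    _ ≤ E α * (2 ^ (m + 1) * (ENNReal.ofReal t⁻¹ ^ j * U) + 2 ^ (m + 1) * (ENNReal.ofReal t * L)) := by
      refine mul_le_mul_right (add_le_add (mul_le_mul_left ?_ _) (mul_le_mul_left ?_ _)) _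
      · exact one_le_pow₀ (by norm_num)
      · exact pow_le_pow_right₀ (by norm_num) (by omega)
    _ = _ := by ring

lemma iter_G (d m : ℕ) (k : ℕ) : ∃ C : ℝ≥0∞, C ≠ ⊤ ∧ ∀ (Ω : Set (Ed d)) (ρ : Ed d → ℝ) (_ : Wt ρ Ω)
    (u : Ed d → ℝ) (D : (Fin d → ℕ) → Ed d → ℝ), IsWeakDerivFamily d Ω m u D →
    ∀ j, j + k ≤ m → ∀ t ∈ Ioo (0 : ℝ) (1 / 2), ∀ x ∈ Ω, LL ρ (GG ρ m D j) x ≤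
      C * (ENNReal.ofReal t⁻¹ ^ j * eLpNorm u ⊤ volume +
        ENNReal.ofReal t ^ k * (LL ρ)^[k + 1] (GG ρ m D (j + k)) x) := by
  induction k with
  | zero =>
    refine ⟨1, by simp, ?_⟩
    intro Ω ρ W u D hD j hj t ht x hx
    simp
  | succ k ih =>
    obtain ⟨C, hC, h⟩ := ih
    obtain ⟨C1, hC1, h1⟩ := one_step_G d m
    refine ⟨C * (1 + C1), by simp [ENNReal.mul_eq_top, hC, hC1], ?_⟩
    intro Ω ρ W u D hD j hj t ht x hx
    have a1 := h Ω ρ W u D hD j (by omega) t ht x hx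
    have a2 := h1 Ω ρ W u D hD (j + k) (by omega) t ht
    simp only [mul_add, ← mul_assoc] at a2
    have a3 := LL_iter W (by simp [ENNReal.mul_eq_top, hC1]) a2 k x hx
    set U := eLpNorm u ⊤ volume
    have e : (LL ρ)^[k + 1] (LL ρ (GG ρ m D (j + k + 1))) x =
        (LL ρ)^[k + 1 + 1] (GG ρ m D (j + (k + 1))) x := rfl
    have a4 : (LL ρ)^[k + 1] (GG ρ m D (j + k)) x ≤ C1 * ENNReal.ofReal t⁻¹ ^ (j + k) * U +
      C1 * ENNReal.ofReal t * (LL ρ)^[k + 1] (LL ρ (GG ρ m D (j + k + 1))) x := a3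
    rw [e] at a4
    set L := (LL ρ)^[k + 1 + 1] (GG ρ m D (j + (k + 1))) x
    have e2 : ENNReal.ofReal t ^ k * ENNReal.ofReal t⁻¹ ^ k = 1 := by
      rw [← mul_pow, ← ENNReal.ofReal_mul ht.1.le, mul_inv_cancel₀ ht.1.ne']; simp
    calc _ ≤ _ := a1
      _ ≤ C * (ENNReal.ofReal t⁻¹ ^ j * U + ENNReal.ofReal t ^ k *
          (C1 * ENNReal.ofReal t⁻¹ ^ (j + k) * U + C1 * ENNReal.ofReal t * L)) :=
        mul_le_mul_right (add_le_add le_rfl (mul_le_mul_right a4 _)) _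
      _ = C * ((1 + C1 * (ENNReal.ofReal t ^ k * ENNReal.ofReal t⁻¹ ^ k)) * (ENNReal.ofReal t⁻¹ ^ j * U)
          + C1 * (ENNReal.ofReal t ^ (k + 1) * L)) := by ring
      _ ≤ C * ((1 + C1) * (ENNReal.ofReal t⁻¹ ^ j * U)
          + (1 + C1) * (ENNReal.ofReal t ^ (k + 1) * L)) := by
        rw [e2, mul_one]
        exact mul_le_mul_right (add_le_add le_rfl (mul_le_mul_left le_add_self _)) _
      _ = _ := by ring

/-- Sum of iterated local maximal functions. -/
def NN {d : ℕ} (ρ : Ed d → ℝ) (m : ℕ) (D : (Fin d → ℕ) → Ed d → ℝ) (x : Ed d) : ℝ≥0∞ :=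
  ∑ n ∈ Finset.range (m + 1), ∑ i ∈ Finset.range (m + 1), (LL ρ)^[i + 1] (GG ρ m D n) x

lemma le_NN {d : ℕ} (ρ : Ed d → ℝ) {m : ℕ} (D : (Fin d → ℕ) → Ed d → ℝ) (x : Ed d) {n i : ℕ}
    (hn : n ≤ m) (hi : i ≤ m) : (LL ρ)^[i + 1] (GG ρ m D n) x ≤ NN ρ m D x := by
  unfold NN
  refine le_trans ?_ (Finset.single_le_sum
    (f := fun n => ∑ i ∈ Finset.range (m + 1), (LL ρ)^[i + 1] (GG ρ m D n) x)
    (fun _ _ => zero_le) (Finset.mem_range.2 (Nat.lt_succ_of_le hn)))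
  exact Finset.single_le_sum
    (f := fun i => (LL ρ)^[i + 1] (GG ρ m D n) x)
    (fun _ _ => zero_le) (Finset.mem_range.2 (Nat.lt_succ_of_le hi))

lemma interp (d m : ℕ) : ∃ C : ℝ≥0∞, C ≠ ⊤ ∧ ∀ (Ω : Set (Ed d)) (ρ : Ed d → ℝ) (_ : Wt ρ Ω)
    (u : Ed d → ℝ) (D : (Fin d → ℕ) → Ed d → ℝ), IsWeakDerivFamily d Ω m u D →
    ∀ j k, j + k ≤ m → ∀ t ∈ Ioo (0 : ℝ) (1 / 2), ∀ x ∈ Ω, LL ρ (GG ρ m D j) x ≤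
      C * (ENNReal.ofReal t⁻¹ ^ j * eLpNorm u ⊤ volume + ENNReal.ofReal t ^ k * NN ρ m D x) := by
  choose C hC h using iter_G d m
  refine ⟨∑ k ∈ Finset.range (m + 1), C k, by simp [ENNReal.sum_eq_top, hC], ?_⟩
  intro Ω ρ W u D hD j k hjk t ht x hx
  refine (h k Ω ρ W u D hD j hjk t ht x hx).trans ?_
  refine mul_le_mul' ?_ (add_le_add le_rfl (mul_le_mul_right (le_NN ρ D x hjk (by omega)) _))
  exact Finset.single_le_sum (f := C) (fun _ _ => zero_le) (Finset.mem_range.2 (by omega))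

lemma sum_rpow_le {ι : Type*} (s : Finset ι) (p : ℝ) (hp : 1 < p) : ∃ K : ℝ≥0∞, K ≠ ⊤ ∧
    ∀ f : ι → ℝ≥0∞, (∑ i ∈ s, f i) ^ p ≤ K * ∑ i ∈ s, f i ^ p :=
  ⟨(s.card : ℝ≥0∞) ^ (p - 1), ENNReal.rpow_ne_top_of_nonneg (by linarith) (by simp),
    fun _ => ENNReal.rpow_sum_le_const_mul_sum_rpow _ _ hp.le⟩

/-- Weighted norm of a family, as an extended real. -/
def EE {d : ℕ} (Ω : Set (Ed d)) (ρ : Ed d → ℝ) (m : ℕ) (a p : ℝ)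
    (D : (Fin d → ℕ) → Ed d → ℝ) : ℝ≥0∞ :=
  ∑ α ∈ multiIdx d m, ∫⁻ x in Ω,
    (ENNReal.ofReal (ρ x ^ (((∑ i, α i : ℕ) : ℝ) - a)) * ‖D α x‖ₑ) ^ p

lemma NN_bound (d m : ℕ) (a p : ℝ) (hp : 1 < p) : ∃ C : ℝ≥0∞, C ≠ ⊤ ∧
    ∀ (Ω : Set (Ed d)) (ρ : Ed d → ℝ) (_ : Wt ρ Ω) (D : (Fin d → ℕ) → Ed d → ℝ),
    (∀ α ∈ multiIdx d m, AEStronglyMeasurable (D α) (volume.restrict Ω)) →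
    ∃ H : Ed d → ℝ≥0∞, Measurable H ∧ (∀ x ∈ Ω, NN ρ m D x ≤ ENNReal.ofReal (ρ x ^ a) * H x) ∧
      ∫⁻ x, H x ^ p ≤ C * EE Ω ρ m a p D := by
  choose K hK hKs using fun k => MM_iter_strong d p hp k
  obtain ⟨S1, hS1, hS1'⟩ := sum_rpow_le (multiIdx d m) p hp
  obtain ⟨S2, hS2, hS2'⟩ := sum_rpow_le (Finset.range (m + 1)) p hp
  set c : ℝ≥0∞ := ENNReal.ofReal (2 ^ |a|) with hc
  have hcp : ∀ i : ℕ, (c ^ i) ^ p ≠ ⊤ := fun i =>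
    ENNReal.rpow_ne_top_of_nonneg (by linarith) (by simp [hc])
  refine ⟨∑ n ∈ Finset.range (m + 1), ∑ i ∈ Finset.range (m + 1),
    S2 * (S2 * ((c ^ (i + 1)) ^ p * (K (i + 1) * S1))), ?_, ?_⟩
  · simp [ENNReal.sum_eq_top, ENNReal.mul_eq_top, hcp, hK, hS1, hS2]
  intro Ω ρ W D hD
  have hΩm : MeasurableSet Ω := (wt_open W).measurableSet
  have hρm : Measurable ρ := (wt_cont W).measurable
  -- measurable representatives
  have hw : ∀ n, ∃ w : Ed d → ℝ≥0∞, Measurable w ∧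
      (∀ᵐ y, y ∈ Ω → GG ρ m D n y ≤ ENNReal.ofReal (ρ y ^ a) * w y) ∧
      ∫⁻ y, w y ^ p ≤ S1 * EE Ω ρ m a p D := by
    intro n
    have hterm : ∀ α ∈ multiIdx d m, AEMeasurable (fun y => (ENNReal.ofReal
        (ρ y ^ (((∑ i, α i : ℕ) : ℝ) - a)) * ‖D α y‖ₑ) ^ p) (volume.restrict Ω) := by
      intro α hα
      have := (hD α hα).enorm
      have h2 : Measurable fun y => ENNReal.ofReal (ρ y ^ (((∑ i, α i : ℕ) : ℝ) - a)) := by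
        fun_prop
      exact (h2.aemeasurable.mul this).pow_const p
    have hG : AEMeasurable (fun y => ENNReal.ofReal (ρ y ^ (-a)) * GG ρ m D n y)
        (volume.restrict Ω) := by
      have h2 : Measurable fun y => ENNReal.ofReal (ρ y ^ (-a)) := by fun_prop
      refine h2.aemeasurable.mul ?_
      unfold GG
      refine Finset.aemeasurable_fun_sum _ fun α hα => ?_
      have h3 : Measurable fun y => ENNReal.ofReal (ρ y ^ n) := by fun_prop
      exact h3.aemeasurable.mul (hD α (Finset.mem_filter.1 hα).1).enorm
    have hGi := (aemeasurable_indicator_iff hΩm).2 hG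
    refine ⟨hGi.mk _, hGi.measurable_mk, ?_, ?_⟩
    · filter_upwards [hGi.ae_eq_mk] with y hy hyΩ
      rw [← hy, indicator_of_mem hyΩ, ← mul_assoc, ← ENNReal.ofReal_mul (Real.rpow_nonneg (W.nonneg y) _),
        ← Real.rpow_add ((W.dom y).1 hyΩ)]
      simp
    · calc ∫⁻ y, (hGi.mk _ y) ^ p = ∫⁻ y, (Ω.indicator
            (fun y => ENNReal.ofReal (ρ y ^ (-a)) * GG ρ m D n y) y) ^ p := by
            apply lintegral_congr_ae
            filter_upwards [hGi.ae_eq_mk] with y hy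
            rw [hy]
        _ = ∫⁻ y in Ω, (ENNReal.ofReal (ρ y ^ (-a)) * GG ρ m D n y) ^ p := by
            rw [← lintegral_indicator hΩm]
            congr 1
            ext y
            by_cases hy : y ∈ Ω
            · simp [hy]
            · simp [hy, ENNReal.zero_rpow_of_pos (by linarith : 0 < p)]
        _ ≤ ∫⁻ y in Ω, S1 * ∑ α ∈ multiIdx d m, (ENNReal.ofReal
            (ρ y ^ (((∑ i, α i : ℕ) : ℝ) - a)) * ‖D α y‖ₑ) ^ p := by
            refine setLIntegral_mono' hΩm fun y hy => ?_
            refine le_trans ?_ (hS1' _)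
            refine ENNReal.rpow_le_rpow ?_ (by linarith)
            unfold GG
            rw [Finset.mul_sum]
            refine le_trans (Finset.sum_le_sum (fun α hα => le_of_eq ?_)) (Finset.sum_le_sum_of_subset (Finset.filter_subset _ _))
            rw [← mul_assoc, ← ENNReal.ofReal_mul (Real.rpow_nonneg (W.nonneg y) _),
              (Finset.mem_filter.1 hα).2, sub_eq_neg_add, Real.rpow_add ((W.dom y).1 hy),
              Real.rpow_natCast]
        _ = _ := by
            rw [lintegral_const_mul' _ _ hS1, lintegral_finsetSum' _ hterm]
            rfl
  choose w hwm hwle hwint using hw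
  refine ⟨fun x => ∑ n ∈ Finset.range (m + 1), ∑ i ∈ Finset.range (m + 1),
    c ^ (i + 1) * MM^[i + 1] (w n) x, ?_, ?_, ?_⟩
  · refine Finset.measurable_fun_sum _ fun n _ => Finset.measurable_fun_sum _ fun i _ => ?_
    exact ((hKs (i + 1) (w n) (hwm n)).1).const_mul _
  · intro x hx
    unfold NN
    simp only [Finset.mul_sum]
    refine Finset.sum_le_sum fun n _ => Finset.sum_le_sum fun i _ => ?_
    refine (LL_weight_iter W a (hwle n) i x hx).trans (le_of_eq ?_)
    ring
  · have hmeas : ∀ n i, Measurable fun x => (c ^ (i + 1) * MM^[i + 1] (w n) x) ^ p := fun n i =>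
      (((hKs (i + 1) (w n) (hwm n)).1).const_mul _).pow_const p
    calc _ ≤ ∫⁻ x, ∑ n ∈ Finset.range (m + 1), ∑ i ∈ Finset.range (m + 1),
          S2 * (S2 * (c ^ (i + 1) * MM^[i + 1] (w n) x) ^ p) := by
          refine lintegral_mono fun x => ?_
          refine (hS2' _).trans ?_
          rw [Finset.mul_sum]
          refine Finset.sum_le_sum fun n _ => ?_
          refine (mul_le_mul_right (hS2' _) _).trans (le_of_eq ?_)
          simp only [Finset.mul_sum]
      _ = ∑ n ∈ Finset.range (m + 1), ∑ i ∈ Finset.range (m + 1),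
          ∫⁻ x, S2 * (S2 * (c ^ (i + 1) * MM^[i + 1] (w n) x) ^ p) := by
          rw [lintegral_finsetSum _ (fun n _ => Finset.measurable_fun_sum _ fun i _ =>
            ((hmeas n i).const_mul _).const_mul _)]
          refine Finset.sum_congr rfl fun n _ => ?_
          rw [lintegral_finsetSum _ (fun i _ => ((hmeas n i).const_mul _).const_mul _)]
      _ ≤ _ := by
          rw [Finset.sum_mul]
          refine Finset.sum_le_sum fun n _ => ?_
          rw [Finset.sum_mul]
          refine Finset.sum_le_sum fun i _ => ?_
          rw [lintegral_const_mul' _ _ hS2, lintegral_const_mul' _ _ hS2, mul_assoc, mul_assoc, mul_assoc, mul_assoc]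
          refine mul_le_mul_right (mul_le_mul_right ?_ _) _
          simp only [ENNReal.mul_rpow_of_nonneg _ _ (by linarith : (0:ℝ) ≤ p)]
          rw [lintegral_const_mul' _ _ (hcp _)]
          refine mul_le_mul_right ?_ _
          exact ((hKs (i + 1) (w n) (hwm n)).2).trans (mul_le_mul_right (hwint n) _)


lemma real_prod {U V Nu Nv gu gv C : ℝ} (hU : 0 ≤ U) (hV : 0 ≤ V) (hNu : 0 ≤ Nu) (hNv : 0 ≤ Nv)
    (hgu : 0 ≤ gu) (hgv : 0 ≤ gv) (hC : 0 ≤ C) {j k : ℕ}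
    (h1 : ∀ t ∈ Ioo (0 : ℝ) (1 / 2), gu ≤ C * (t⁻¹ ^ j * U + t ^ k * Nu))
    (h2 : ∀ t ∈ Ioo (0 : ℝ) (1 / 2), gv ≤ C * (t⁻¹ ^ k * V + t ^ j * Nv))
    (h0 : j + k = 0 → ∀ t ∈ Ioo (0 : ℝ) (1 / 2), gu ≤ C * (U + t * Nu))
    (hu : gu ≤ Nu) (hv : gv ≤ Nv) :
    gu * gv ≤ (3 * C ^ 2 + 4 ^ (j + k) + C) * (U * Nv + V * Nu) := by
  set n := j + k with hn
  set W := U * Nv + V * Nu with hW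
  have hUN : 0 ≤ U * Nv := by positivity
  have hVN : 0 ≤ V * Nu := by positivity
  have hW0 : 0 ≤ W := by positivity
  have h4 : (0 : ℝ) < 4 ^ n := by positivity
  by_cases hn0 : n = 0
  · have h3 : gu ≤ C * U := by
      have hlim : Tendsto (fun t : ℝ => C * (U + t * Nu)) (𝓝[>] 0) (𝓝 (C * (U + 0 * Nu))) :=
        (Continuous.tendsto (by fun_prop) 0).mono_left nhdsWithin_le_nhds
      have := ge_of_tendsto hlim (by
        filter_upwards [Ioo_mem_nhdsGT (by norm_num : (0:ℝ) < 1 / 2)] with t ht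
        exact h0 hn0 t ht)
      simpa using this
    calc gu * gv ≤ (C * U) * Nv := mul_le_mul h3 hv hgv (by positivity)
      _ = C * (U * Nv) := by ring
      _ ≤ C * W := mul_le_mul_of_nonneg_left (by linarith) hC
      _ ≤ _ := mul_le_mul_of_nonneg_right (by nlinarith [sq_nonneg C]) hW0
  have key : ∀ t ∈ Ioo (0 : ℝ) (1 / 2),
      gu * gv ≤ C ^ 2 * (t⁻¹ ^ n * (U * V) + W + t ^ n * (Nu * Nv)) := by
    intro t ht
    have ht0 := ht.1
    calc gu * gv ≤ (C * (t⁻¹ ^ j * U + t ^ k * Nu)) * (C * (t⁻¹ ^ k * V + t ^ j * Nv)) :=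
          mul_le_mul (h1 t ht) (h2 t ht) hgv (by positivity)
      _ = C ^ 2 * (t⁻¹ ^ (j + k) * (U * V) + ((t⁻¹ * t) ^ j * (U * Nv) + (t⁻¹ * t) ^ k * (V * Nu)) +
          t ^ (j + k) * (Nu * Nv)) := by simp only [mul_pow, pow_add]; ring
      _ = _ := by rw [inv_mul_cancel₀ ht0.ne', one_pow, one_pow, one_mul, one_mul]
  by_cases hA : U * V = 0
  · have hlim : Tendsto (fun t : ℝ => C ^ 2 * (W + t ^ n * (Nu * Nv))) (𝓝[>] 0)
        (𝓝 (C ^ 2 * (W + 0 ^ n * (Nu * Nv)))) :=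
      (Continuous.tendsto (by fun_prop) 0).mono_left nhdsWithin_le_nhds
    have := ge_of_tendsto hlim (by
        filter_upwards [Ioo_mem_nhdsGT (by norm_num : (0:ℝ) < 1 / 2)] with t ht
        have := key t ht
        rw [hA, mul_zero, zero_add] at this
        exact this)
    rw [zero_pow hn0, zero_mul, add_zero] at this
    refine this.trans (mul_le_mul_of_nonneg_right (by nlinarith [sq_nonneg C]) hW0)
  have hA0 : 0 < U * V := lt_of_le_of_ne (by positivity) (Ne.symm hA)
  have hAB : (U * V) * (Nu * Nv) ≤ W ^ 2 := by
    rw [hW]; nlinarith [mul_nonneg hUN hVN, sq_nonneg (U * Nv), sq_nonneg (V * Nu)]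
  by_cases hW1 : W = 0
  · have : U * Nv = 0 := by linarith
    have hU' : U ≠ 0 := fun h => hA (by rw [h, zero_mul])
    have hNv0 : Nv = 0 := by simpa [hU'] using this
    have : gv = 0 := by linarith
    rw [this, mul_zero]; positivity
  have hWp : 0 < W := lt_of_le_of_ne hW0 (Ne.symm hW1)
  rcases lt_or_ge (U * V * 4 ^ n) W with hc | hc
  · set q := U * V / W with hq
    have hq0 : 0 < q := by positivity
    set t := q ^ ((n : ℝ)⁻¹) with ht
    have ht0 : 0 < t := by positivity
    have htn : t ^ n = q := Real.rpow_inv_natCast_pow hq0.le hn0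
    have ht4 : t < 1 / 2 := by
      by_contra hcon
      push Not at hcon
      have h5 : (1 / 4 : ℝ) ^ n ≤ t ^ n := by gcongr; linarith
      rw [htn, hq, le_div_iff₀ hWp, one_div, inv_pow, inv_mul_le_iff₀ h4] at h5
      linarith
    have h6 := key t ⟨ht0, ht4⟩
    have e1 : t⁻¹ ^ n * (U * V) = W := by
      rw [inv_pow, htn, hq, inv_div, div_mul_cancel₀ _ hA]
    have e2 : t ^ n * (Nu * Nv) ≤ W := by
      rw [htn, hq, div_mul_eq_mul_div, div_le_iff₀ hWp]
      nlinarith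
    calc gu * gv ≤ _ := h6
      _ ≤ C ^ 2 * (W + W + W) := mul_le_mul_of_nonneg_left (by linarith) (by positivity)
      _ = 3 * C ^ 2 * W := by ring
      _ ≤ _ := mul_le_mul_of_nonneg_right (by linarith) hW0
  · have hB : Nu * Nv ≤ 4 ^ n * W := by
      have : (U * V) * (Nu * Nv) ≤ (U * V) * (4 ^ n * W) := by nlinarith
      exact le_of_mul_le_mul_left this hA0
    calc gu * gv ≤ Nu * Nv := mul_le_mul hu hv hgv hNu
      _ ≤ 4 ^ n * W := hB
      _ ≤ _ := mul_le_mul_of_nonneg_right (by nlinarith [sq_nonneg C]) hW0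

lemma ofReal_bound {g C T U N : ℝ≥0∞} {t : ℝ} (ht : 0 < t) {j k : ℕ} (hC : C ≠ ⊤) (hU : U ≠ ⊤)
    (hN : N ≠ ⊤) (hT : T = ENNReal.ofReal t⁻¹)
    (h : g ≤ C * (T ^ j * U + ENNReal.ofReal t ^ k * N)) :
    g.toReal ≤ C.toReal * (t⁻¹ ^ j * U.toReal + t ^ k * N.toReal) := by
  subst hT
  have hfin1 : ENNReal.ofReal t⁻¹ ^ j * U ≠ ⊤ := by simp [ENNReal.mul_eq_top, hU]
  have hfin2 : ENNReal.ofReal t ^ k * N ≠ ⊤ := by simp [ENNReal.mul_eq_top, hN]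
  have := ENNReal.toReal_mono (ENNReal.mul_ne_top hC (ENNReal.add_ne_top.2 ⟨hfin1, hfin2⟩)) h
  rw [ENNReal.toReal_mul, ENNReal.toReal_add hfin1 hfin2, ENNReal.toReal_mul, ENNReal.toReal_mul,
    ENNReal.toReal_pow, ENNReal.toReal_pow, ENNReal.toReal_ofReal (by positivity),
    ENNReal.toReal_ofReal ht.le] at this
  exact this

/-- Pointwise product bound. -/
lemma prod_bound (d m : ℕ) (hm : 1 ≤ m) : ∃ K : ℝ≥0∞, K ≠ ⊤ ∧
    ∀ (Ω : Set (Ed d)) (ρ : Ed d → ℝ) (_ : Wt ρ Ω)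
    (u v : Ed d → ℝ) (D D' : (Fin d → ℕ) → Ed d → ℝ), IsWeakDerivFamily d Ω m u D →
    IsWeakDerivFamily d Ω m v D' → eLpNorm u ⊤ volume ≠ ⊤ → eLpNorm v ⊤ volume ≠ ⊤ →
    ∀ j k, j + k ≤ m → ∀ x ∈ Ω, NN ρ m D x ≠ ⊤ → NN ρ m D' x ≠ ⊤ →
    LL ρ (GG ρ m D j) x * LL ρ (GG ρ m D' k) x ≤
      K * (eLpNorm u ⊤ volume * NN ρ m D' x + eLpNorm v ⊤ volume * NN ρ m D x) := by
  obtain ⟨C, hC, h⟩ := interp d m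
  refine ⟨ENNReal.ofReal (3 * C.toReal ^ 2 + 4 ^ m + C.toReal), by simp, ?_⟩
  intro Ω ρ W u v D D' hD hD' hU hV j k hjk x hx hN hN'
  have hle1 : LL ρ (GG ρ m D j) x ≤ NN ρ m D x := le_NN ρ D x (n := j) (i := 0) (by omega) (by omega)
  have hle2 : LL ρ (GG ρ m D' k) x ≤ NN ρ m D' x :=
    le_NN ρ D' x (n := k) (i := 0) (by omega) (by omega)
  have hf1 : LL ρ (GG ρ m D j) x ≠ ⊤ := ne_top_of_le_ne_top hN hle1
  have hf2 : LL ρ (GG ρ m D' k) x ≠ ⊤ := ne_top_of_le_ne_top hN' hle2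
  have key := real_prod (U := (eLpNorm u ⊤ volume).toReal) (V := (eLpNorm v ⊤ volume).toReal)
    (Nu := (NN ρ m D x).toReal) (Nv := (NN ρ m D' x).toReal)
    (gu := (LL ρ (GG ρ m D j) x).toReal) (gv := (LL ρ (GG ρ m D' k) x).toReal) (C := C.toReal)
    (j := j) (k := k)
    ENNReal.toReal_nonneg ENNReal.toReal_nonneg ENNReal.toReal_nonneg ENNReal.toReal_nonneg
    ENNReal.toReal_nonneg ENNReal.toReal_nonneg ENNReal.toReal_nonneg
    (fun t ht => ofReal_bound ht.1 hC hU hN rfl (h Ω ρ W u D hD j k hjk t ht x hx))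
    (fun t ht => ofReal_bound ht.1 hC hV hN' rfl (h Ω ρ W v D' hD' k j (by omega) t ht x hx))
    (fun h0 t ht => by
      have hj0 : j = 0 := by omega
      subst hj0
      have := ofReal_bound ht.1 hC hU hN rfl (h Ω ρ W u D hD 0 1 (by omega) t ht x hx)
      simpa using this)
    (ENNReal.toReal_mono hN hle1) (ENNReal.toReal_mono hN' hle2)
  have hW : eLpNorm u ⊤ volume * NN ρ m D' x + eLpNorm v ⊤ volume * NN ρ m D x ≠ ⊤ :=
    ENNReal.add_ne_top.2 ⟨ENNReal.mul_ne_top hU hN', ENNReal.mul_ne_top hV hN⟩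
  rw [← ENNReal.toReal_le_toReal (ENNReal.mul_ne_top hf1 hf2) (ENNReal.mul_ne_top (by simp) hW),
    ENNReal.toReal_mul, ENNReal.toReal_mul, ENNReal.toReal_ofReal (by positivity),
    ENNReal.toReal_add (ENNReal.mul_ne_top hU hN') (ENNReal.mul_ne_top hV hN), ENNReal.toReal_mul,
    ENNReal.toReal_mul]
  refine key.trans (mul_le_mul_of_nonneg_right ?_ (by positivity))
  have : (4 : ℝ) ^ (j + k) ≤ 4 ^ m := pow_le_pow_right₀ (by norm_num) hjk
  linarith


/-- Standing data for products. -/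
structure Pkg {d : ℕ} (Ω : Set (Ed d)) (ρ : Ed d → ℝ) (m : ℕ) (a p : ℝ) (u v : Ed d → ℝ)
    (D D' : (Fin d → ℕ) → Ed d → ℝ) (Hs : Ed d → ℝ≥0∞) (κ : ℝ≥0∞) : Prop where
  W : Wt ρ Ω
  hp : 1 < p
  hD : IsWeakDerivFamily d Ω m u D
  hD' : IsWeakDerivFamily d Ω m v D'
  hκ : κ ≠ ⊤
  meas : Measurable Hs
  fin : ∫⁻ x, Hs x ^ p ≠ ⊤
  bd : ∀ᵐ x, x ∈ Ω → ∀ j k, j + k ≤ m →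
    LL ρ (GG ρ m D j) x * LL ρ (GG ρ m D' k) x ≤ κ * (ENNReal.ofReal (ρ x ^ a) * Hs x)

lemma pkg_exists (d m : ℕ) (hm : 1 ≤ m) (a p : ℝ) (hp : 1 < p) : ∃ κ C : ℝ≥0∞, κ ≠ ⊤ ∧ C ≠ ⊤ ∧
    ∀ (Ω : Set (Ed d)) (ρ : Ed d → ℝ) (_ : Wt ρ Ω)
    (u v : Ed d → ℝ) (D D' : (Fin d → ℕ) → Ed d → ℝ), IsWeakDerivFamily d Ω m u D →
    IsWeakDerivFamily d Ω m v D' → eLpNorm u ⊤ volume ≠ ⊤ → eLpNorm v ⊤ volume ≠ ⊤ →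
    EE Ω ρ m a p D ≠ ⊤ → EE Ω ρ m a p D' ≠ ⊤ → ∃ Hs, Pkg Ω ρ m a p u v D D' Hs κ ∧
      ∫⁻ x, Hs x ^ p ≤ C * (eLpNorm u ⊤ volume ^ p * EE Ω ρ m a p D' +
        eLpNorm v ⊤ volume ^ p * EE Ω ρ m a p D) := by
  obtain ⟨K, hK, hKb⟩ := prod_bound d m hm
  obtain ⟨C, hC, hCb⟩ := NN_bound d m a p hp
  have hp0 : (0 : ℝ) ≤ p := by linarith
  have h2 : (2 : ℝ≥0∞) ^ (p - 1) ≠ ⊤ := ENNReal.rpow_ne_top_of_nonneg (by linarith) (by simp)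
  refine ⟨K, 2 ^ (p - 1) * C, hK, ENNReal.mul_ne_top h2 hC, ?_⟩
  intro Ω ρ W u v D D' hD hD' hU hV hE hE'
  have hms : ∀ {w : Ed d → ℝ} {D : (Fin d → ℕ) → Ed d → ℝ}, IsWeakDerivFamily d Ω m w D →
      ∀ α ∈ multiIdx d m, AEStronglyMeasurable (D α) (volume.restrict Ω) :=
    fun h α hα => (h α hα).2.1.aestronglyMeasurable
  obtain ⟨H, hH, hH1, hH2⟩ := hCb Ω ρ W D (hms hD)
  obtain ⟨H', hH', hH1', hH2'⟩ := hCb Ω ρ W D' (hms hD')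
  have hHf : ∫⁻ x, H x ^ p ≠ ⊤ := ne_top_of_le_ne_top (ENNReal.mul_ne_top hC hE) hH2
  have hHf' : ∫⁻ x, H' x ^ p ≠ ⊤ := ne_top_of_le_ne_top (ENNReal.mul_ne_top hC hE') hH2'
  set U := eLpNorm u ⊤ volume
  set V := eLpNorm v ⊤ volume
  have hbound : ∫⁻ x, (U * H' x + V * H x) ^ p ≤
      2 ^ (p - 1) * C * (U ^ p * EE Ω ρ m a p D' + V ^ p * EE Ω ρ m a p D) := by
    calc ∫⁻ x, (U * H' x + V * H x) ^ p ≤ ∫⁻ x, 2 ^ (p - 1) * (U ^ p * H' x ^ p + V ^ p * H x ^ p) := by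
          refine lintegral_mono fun x => ?_
          refine (ENNReal.rpow_add_le_mul_rpow_add_rpow _ _ hp.le).trans (le_of_eq ?_)
          rw [ENNReal.mul_rpow_of_nonneg _ _ hp0, ENNReal.mul_rpow_of_nonneg _ _ hp0]
      _ = 2 ^ (p - 1) * (U ^ p * (∫⁻ x, H' x ^ p) + V ^ p * (∫⁻ x, H x ^ p)) := by
          rw [lintegral_const_mul' _ _ h2, lintegral_add_left ((hH'.pow_const p).const_mul _),
            lintegral_const_mul _ (hH'.pow_const p), lintegral_const_mul _ (hH.pow_const p)]
      _ ≤ 2 ^ (p - 1) * (U ^ p * (C * EE Ω ρ m a p D') + V ^ p * (C * EE Ω ρ m a p D)) :=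
          mul_le_mul_right (add_le_add (mul_le_mul_right hH2' _) (mul_le_mul_right hH2 _)) _
      _ = _ := by ring
  refine ⟨fun x => U * H' x + V * H x, ⟨W, hp, hD, hD', hK, ?_, ?_, ?_⟩, hbound⟩
  · exact (hH'.const_mul _).add (hH.const_mul _)
  · refine ne_top_of_le_ne_top ?_ hbound
    have hUp : U ^ p ≠ ⊤ := ENNReal.rpow_ne_top_of_nonneg hp0 hU
    have hVp : V ^ p ≠ ⊤ := ENNReal.rpow_ne_top_of_nonneg hp0 hV
    exact ENNReal.mul_ne_top (ENNReal.mul_ne_top h2 hC)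
      (ENNReal.add_ne_top.2 ⟨ENNReal.mul_ne_top hUp hE', ENNReal.mul_ne_top hVp hE⟩)
  · have f1 := ae_lt_top (hH.pow_const p) hHf
    have f2 := ae_lt_top (hH'.pow_const p) hHf'
    filter_upwards [f1, f2] with x hx1 hx2 hxΩ j k hjk
    have g1 : H x ≠ ⊤ := by
      intro h; rw [h, ENNReal.top_rpow_of_pos (by linarith)] at hx1; exact lt_irrefl _ hx1
    have g2 : H' x ≠ ⊤ := by
      intro h; rw [h, ENNReal.top_rpow_of_pos (by linarith)] at hx2; exact lt_irrefl _ hx2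
    have n1 : NN ρ m D x ≠ ⊤ := ne_top_of_le_ne_top (ENNReal.mul_ne_top (by simp) g1) (hH1 x hxΩ)
    have n2 : NN ρ m D' x ≠ ⊤ := ne_top_of_le_ne_top (ENNReal.mul_ne_top (by simp) g2) (hH1' x hxΩ)
    refine (hKb Ω ρ W u v D D' hD hD' hU hV j k hjk x hxΩ n1 n2).trans (mul_le_mul_right ?_ _)
    calc _ ≤ U * (ENNReal.ofReal (ρ x ^ a) * H' x) + V * (ENNReal.ofReal (ρ x ^ a) * H x) :=
          add_le_add (mul_le_mul_right (hH1' x hxΩ) _) (mul_le_mul_right (hH1 x hxΩ) _)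
      _ = _ := by ring

section pkg

variable {d : ℕ} {Ω : Set (Ed d)} {ρ : Ed d → ℝ} {m : ℕ} {a p : ℝ} {u v : Ed d → ℝ}
    {D D' : (Fin d → ℕ) → Ed d → ℝ} {Hs : Ed d → ℝ≥0∞} {κ : ℝ≥0∞}

lemma pkg_int (P : Pkg Ω ρ m a p u v D D' Hs κ) {S : Set (Ed d)} (hS : IsCompact S) :
    ∫⁻ x in S, Hs x ≠ ⊤ := by
  have hp := P.hp
  have h1 : ∀ x : ℝ≥0∞, x ≤ 1 + x ^ p := by
    intro x
    rcases le_total x 1 with h | h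
    · exact h.trans le_self_add
    · refine le_trans ?_ le_add_self
      conv_lhs => rw [← ENNReal.rpow_one x]
      exact ENNReal.rpow_le_rpow_of_exponent_le h hp.le
  refine ne_top_of_le_ne_top ?_ (lintegral_mono fun x => h1 (Hs x))
  rw [lintegral_add_left measurable_const]
  refine ENNReal.add_ne_top.2 ⟨?_, ?_⟩
  · simpa using hS.measure_lt_top.ne
  · exact ne_top_of_le_ne_top P.fin (setLIntegral_le_lintegral _ _)

lemma pkg_dom (P : Pkg Ω ρ m a p u v D D' Hs κ) {S : Set (Ed d)} (hS : IsCompact S) (hSΩ : S ⊆ Ω)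
    {c₁ c₂ : ℝ≥0∞} (h₁ : c₁ ≠ ⊤) (h₂ : c₂ ≠ ⊤) : ∃ M : ℝ≥0∞, M ≠ ⊤ ∧ ∀ᵐ x, x ∈ S →
      ∀ j k, j + k ≤ m → ∀ X Y : ℝ≥0∞,
        ENNReal.ofReal (ρ x ^ j) * X ≤ c₁ * LL ρ (GG ρ m D j) x →
        ENNReal.ofReal (ρ x ^ k) * Y ≤ c₂ * LL ρ (GG ρ m D' k) x → X * Y ≤ M * Hs x := by
  obtain ⟨c, hc, hcS⟩ := hS.exists_forall_le' (wt_cont P.W).continuousOn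
    (fun x hx => (P.W.dom x).1 (hSΩ hx))
  set c0 := min c 1
  have hc0 : 0 < c0 := lt_min hc one_pos
  have hne : ENNReal.ofReal (c0 ^ m) ≠ 0 := by
    rw [Ne, ENNReal.ofReal_eq_zero, not_le]; positivity
  refine ⟨(c₁ * c₂ * κ * ENNReal.ofReal (1 + c ^ a)) / ENNReal.ofReal (c0 ^ m), ?_, ?_⟩
  · exact ENNReal.div_ne_top (ENNReal.mul_ne_top (ENNReal.mul_ne_top (ENNReal.mul_ne_top h₁ h₂) P.hκ)
      (by simp)) hne
  filter_upwards [P.bd] with x hx hxS j k hjk X Y hX hY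
  have hr := hcS x hxS
  have hr0 : 0 < ρ x := hc.trans_le hr
  have hr1 := P.W.le_one x
  have e1 : ENNReal.ofReal (c0 ^ m) ≤ ENNReal.ofReal (ρ x ^ j) * ENNReal.ofReal (ρ x ^ k) := by
    rw [← ENNReal.ofReal_mul (by positivity), ← pow_add]
    refine ENNReal.ofReal_le_ofReal ?_
    calc c0 ^ m ≤ c0 ^ (j + k) := pow_le_pow_of_le_one hc0.le (min_le_right _ _) hjk
      _ ≤ _ := pow_le_pow_left₀ hc0.le ((min_le_left _ _).trans hr) _
  have e2 : ENNReal.ofReal (ρ x ^ a) ≤ ENNReal.ofReal (1 + c ^ a) := by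
    refine ENNReal.ofReal_le_ofReal ?_
    rcases le_or_gt 0 a with ha | ha
    · have := Real.rpow_le_one hr0.le hr1 ha
      have : 0 ≤ c ^ a := by positivity
      linarith
    · have := Real.rpow_le_rpow_of_nonpos hc hr ha.le
      linarith
  rw [← ENNReal.mul_div_right_comm, ENNReal.le_div_iff_mul_le (Or.inl hne) (Or.inl (by simp))]
  calc X * Y * ENNReal.ofReal (c0 ^ m)
      ≤ X * Y * (ENNReal.ofReal (ρ x ^ j) * ENNReal.ofReal (ρ x ^ k)) := mul_le_mul_right e1 _
    _ = (ENNReal.ofReal (ρ x ^ j) * X) * (ENNReal.ofReal (ρ x ^ k) * Y) := by ring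
    _ ≤ (c₁ * LL ρ (GG ρ m D j) x) * (c₂ * LL ρ (GG ρ m D' k) x) := mul_le_mul' hX hY
    _ = c₁ * c₂ * (LL ρ (GG ρ m D j) x * LL ρ (GG ρ m D' k) x) := by ring
    _ ≤ c₁ * c₂ * (κ * (ENNReal.ofReal (1 + c ^ a) * Hs x)) :=
      mul_le_mul_right ((hx (hSΩ hxS) j k hjk).trans
        (mul_le_mul_right (mul_le_mul_left e2 _) _)) _
    _ = _ := by ring

end pkg

/-- Mollification of `f` cut off to `K`. -/
def MO {d : ℕ} (K : Set (Ed d)) (f : Ed d → ℝ) (ε : ℝ) (x : Ed d) : ℝ :=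
  ∫ y, K.indicator f y * Ker (psi d) ε x y

lemma mo_aux {d : ℕ} {k : Ed d → ℝ} (hk : IsKer k) {ε : ℝ} (hε : 0 < ε) :
    ContDiff ℝ (⊤ : ℕ∞) (fun z : Ed d => (ε ^ d)⁻¹ * k (ε⁻¹ • z)) ∧
    HasCompactSupport (fun z : Ed d => (ε ^ d)⁻¹ * k (ε⁻¹ • z)) := by
  constructor
  · exact contDiff_const.mul (ContDiff.comp hk.1 (contDiff_id.const_smul ε⁻¹))
  · exact ((isKer_compact hk).comp_smul (inv_ne_zero hε.ne')).mul_left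

lemma mo_conv {d : ℕ} (k : Ed d → ℝ) (f : Ed d → ℝ) (ε : ℝ) :
    (fun x => ∫ y, f y * Ker k ε x y) =
      convolution f (fun z : Ed d => (ε ^ d)⁻¹ * k (ε⁻¹ • z)) (ContinuousLinearMap.lsmul ℝ ℝ) volume := by
  ext x
  rw [convolution_def]
  rfl

lemma mo_smooth {d : ℕ} {K : Set (Ed d)} (hK : MeasurableSet K) {f : Ed d → ℝ}
    (hf : IntegrableOn f K) {ε : ℝ} (hε : 0 < ε) : Smth (MO K f ε) := by
  have h : MO K f ε = _ := mo_conv (psi d) (K.indicator f) ε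
  rw [h]
  exact (mo_aux (psi_isKer d) hε).2.contDiff_convolution_right _
    ((integrable_indicator_iff hK).2 hf).locallyIntegrable (mo_aux (psi_isKer d) hε).1

lemma ker_ind {d : ℕ} {K : Set (Ed d)} {k f : Ed d → ℝ} (hk : IsKer k) {ε : ℝ} (hε : 0 < ε) {x : Ed d}
    (hx : closedBall x ε ⊆ K) (y : Ed d) : K.indicator f y * Ker k ε x y = f y * Ker k ε x y := by
  by_cases hy : y ∈ K
  · rw [indicator_of_mem hy]
  · rw [ker_zero hk hε (fun h => hy (hx (ball_subset_closedBall h))), mul_zero, mul_zero]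

lemma mo_eq {d : ℕ} {K : Set (Ed d)} {f : Ed d → ℝ} {ε : ℝ} (hε : 0 < ε) {x : Ed d}
    (hx : closedBall x ε ⊆ K) : MO K f ε x = ∫ y, f y * Ker (psi d) ε x y := by
  unfold MO
  simp only [ker_ind (psi_isKer d) hε hx]

lemma mo_deriv {d : ℕ} {K : Set (Ed d)} (hK : MeasurableSet K) {f : Ed d → ℝ}
    (hf : IntegrableOn f K) {ε : ℝ} (hε : 0 < ε) (i : Fin d) {x : Ed d} (hx : closedBall x ε ⊆ K) :
    pderivI d i (MO K f ε) x = - ∫ y, f y * pderivI d i (Ker (psi d) ε x) y := by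
  have h : MO K f ε = _ := mo_conv (psi d) (K.indicator f) ε
  have h1 := (mo_aux (psi_isKer d) hε).2.hasFDerivAt_convolution_right (ContinuousLinearMap.lsmul ℝ ℝ)
    ((integrable_indicator_iff hK).2 hf).locallyIntegrable ((mo_aux (psi_isKer d) hε).1.of_le (by simp)) x
  unfold pderivI
  rw [h, h1.fderiv]
  have hc : HasCompactSupport (fderiv ℝ (fun z : Ed d => (ε ^ d)⁻¹ * psi d (ε⁻¹ • z))) :=
    (mo_aux (psi_isKer d) hε).2.fderiv (𝕜 := ℝ)
  rw [convolution_precompR_apply (L := ContinuousLinearMap.lsmul ℝ ℝ)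
    ((integrable_indicator_iff hK).2 hf).locallyIntegrable hc
    ((mo_aux (psi_isKer d) hε).1.continuous_fderiv (by simp))]
  rw [convolution_def, ← integral_neg]
  congr 1
  ext y
  have e1 : fderiv ℝ (fun z : Ed d => (ε ^ d)⁻¹ * psi d (ε⁻¹ • z)) (x - y) (EuclideanSpace.single i 1) =
      ε⁻¹ * Ker (pderivI d i (psi d)) ε x y := by
    have := congrFun (pderivI_scale (psi_isKer d).1 (ε ^ d)⁻¹ (-ε⁻¹) 0 i) (x - y)
    simp only [zero_sub, smul_neg, neg_smul, neg_neg] at this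
    unfold pderivI at this
    rw [this]
    unfold Ker pderivI
    ring
  have e2 := pderivI_ker i (psi_isKer d).1 ε x y
  unfold pderivI at e2
  rw [e1, e2]
  have := ker_ind (f := f) (isKer_pderivI (psi_isKer d) i) hε hx y
  simp only [ContinuousLinearMap.lsmul_apply, smul_eq_mul]
  rw [mul_left_comm, this]
  unfold pderivI
  ring


section pkg

variable {d : ℕ} {Ω : Set (Ed d)} {ρ : Ed d → ℝ} {m : ℕ} {a p : ℝ} {u v : Ed d → ℝ}
    {D D' : (Fin d → ℕ) → Ed d → ℝ} {Hs : Ed d → ℝ≥0∞} {κ : ℝ≥0∞}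

lemma pkg_leb (P : Pkg Ω ρ m a p u v D D' Hs κ) :
    ∀ᵐ x, ∀ α ∈ multiIdx d m, x ∈ Ω → LebPt (D α) x ∧ LebPt (D' α) x := by
  rw [eventually_all_finset]
  intro α hα
  filter_upwards [lebPt_ae P.W (P.hD α hα).2.1, lebPt_ae P.W (P.hD' α hα).2.1] with x h1 h2 hx
  exact ⟨h1 hx, h2 hx⟩

lemma pkg_prod_le (P : Pkg Ω ρ m a p u v D D' Hs κ) {S : Set (Ed d)} (hS : IsCompact S) (hSΩ : S ⊆ Ω)
    {β γ : Fin d → ℕ} (h : ∑ i, β i + ∑ i, γ i ≤ m) : ∃ M : ℝ≥0∞, M ≠ ⊤ ∧ ∀ᵐ x, x ∈ S →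
      ‖D β x‖ₑ * ‖D' γ x‖ₑ ≤ M * Hs x := by
  have hβ : β ∈ multiIdx d m := mem_multiIdx.2 (by omega)
  have hγ : γ ∈ multiIdx d m := mem_multiIdx.2 (by omega)
  obtain ⟨M, hM, hMb⟩ := pkg_dom P hS hSΩ (c₁ := 2 ^ (∑ i, β i)) (c₂ := 2 ^ (∑ i, γ i))
    (by simp) (by simp)
  refine ⟨M, hM, ?_⟩
  filter_upwards [hMb, pkg_leb P] with x hx hL hxS
  have hxΩ := hSΩ hxS
  exact hx hxS _ _ h _ _ (deriv_le_LL P.W hβ hxΩ (P.hD β hβ).2.1 (hL β hβ hxΩ).1)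
    (deriv_le_LL P.W hγ hxΩ (P.hD' γ hγ).2.1 (hL γ hγ hxΩ).2)

lemma pkg_locint (P : Pkg Ω ρ m a p u v D D' Hs κ)
    {β γ : Fin d → ℕ} (h : ∑ i, β i + ∑ i, γ i ≤ m) :
    LocallyIntegrableOn (fun x => D β x * D' γ x) Ω volume := by
  have hβ : β ∈ multiIdx d m := mem_multiIdx.2 (by omega)
  have hγ : γ ∈ multiIdx d m := mem_multiIdx.2 (by omega)
  rw [locallyIntegrableOn_iff (wt_open P.W).isLocallyClosed]
  intro S hSΩ hS
  obtain ⟨M, hM, hMb⟩ := pkg_prod_le P hS hSΩ h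
  refine ⟨?_, ?_⟩
  · exact ((P.hD β hβ).2.1.integrableOn_compact_subset hSΩ hS).aestronglyMeasurable.mul
      ((P.hD' γ hγ).2.1.integrableOn_compact_subset hSΩ hS).aestronglyMeasurable
  · rw [hasFiniteIntegral_iff_enorm]
    calc ∫⁻ x in S, ‖D β x * D' γ x‖ₑ ≤ ∫⁻ x in S, M * Hs x := by
          apply lintegral_mono_ae
          rw [ae_restrict_iff' hS.measurableSet]
          filter_upwards [hMb] with x hx hxS
          rw [enorm_mul]
          exact hx hxS
      _ = M * ∫⁻ x in S, Hs x := lintegral_const_mul' _ _ hM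
      _ < ⊤ := (ENNReal.mul_ne_top hM (pkg_int P hS)).lt_top

lemma moll_lim (P : Pkg Ω ρ m a p u v D D' Hs κ)
    {β γ : Fin d → ℕ} (h : ∑ i, β i + ∑ i, γ i ≤ m) {S K : Set (Ed d)} (hS : IsCompact S)
    (hK : IsCompact K) (hKΩ : K ⊆ Ω) {δ : ℝ} (hδ : 0 < δ) (hSK : ∀ x ∈ S, closedBall x δ ⊆ K)
    (hδρ : ∀ x ∈ S, δ ≤ ρ x / 2) {φ : Ed d → ℝ} (hφ : Continuous φ) (hφS : ∀ x, x ∉ S → φ x = 0) :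
    (∀ ε ∈ Ioo 0 δ, Integrable (fun x => D' γ x * (MO K (D β) ε x * φ x))) ∧
    Tendsto (fun ε => ∫ x, D' γ x * (MO K (D β) ε x * φ x)) (𝓝[>] 0)
      (𝓝 (∫ x, D' γ x * (D β x * φ x))) := by
  have hβ : β ∈ multiIdx d m := mem_multiIdx.2 (by omega)
  have hγ : γ ∈ multiIdx d m := mem_multiIdx.2 (by omega)
  have hSΩ : S ⊆ Ω := fun x hx => hKΩ (hSK x hx (mem_closedBall_self hδ.le))
  have hiβ : IntegrableOn (D β) K := (P.hD β hβ).2.1.integrableOn_compact_subset hKΩ hK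
  have hiγ : IntegrableOn (D' γ) S := (P.hD' γ hγ).2.1.integrableOn_compact_subset hSΩ hS
  have hIntg : ∀ ε ∈ Ioo 0 δ, IntegrableOn (fun x => D' γ x * (MO K (D β) ε x * φ x)) S := by
    intro ε hε
    have hc : Continuous (MO K (D β) ε) := (mo_smooth hK.measurableSet hiβ hε.1).continuous
    exact hiγ.mul_continuousOn (hc.mul hφ).continuousOn hS
  refine ⟨fun ε hε => ?_, ?_⟩
  · rw [← integrableOn_iff_integrable_of_support_subset (s := S)]
    · exact hIntg ε hε
    · intro x hx
      by_contra hxS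
      exact hx (by simp [hφS x hxS])
  have e : ∀ g : Ed d → ℝ, ∫ x, D' γ x * (g x * φ x) = ∫ x in S, D' γ x * (g x * φ x) := by
    intro g
    symm
    apply setIntegral_eq_integral_of_forall_compl_eq_zero
    intro x hx
    simp [hφS x hx]
  simp only [e]
  obtain ⟨B, hB⟩ := hS.exists_bound_of_continuousOn hφ.continuousOn
  obtain ⟨C, hC, hCb⟩ := ker_bound_int (psi_isKer d)
  obtain ⟨M, hM, hMb⟩ := pkg_dom P hS hSΩ (c₁ := C * 2 ^ (∑ i, β i)) (c₂ := 2 ^ (∑ i, γ i))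
    (ENNReal.mul_ne_top hC (by simp)) (by simp)
  have hHfin : ∀ᵐ x ∂(volume.restrict S), Hs x < ⊤ := ae_lt_top P.meas (pkg_int P hS)
  have hball : ∀ ε ∈ Ioo 0 δ, ∀ x ∈ S, closedBall x ε ⊆ K := fun ε hε x hx =>
    (closedBall_subset_closedBall hε.2.le).trans (hSK x hx)
  refine tendsto_integral_filter_of_dominated_convergence (fun x => (M * Hs x).toReal * B) ?_ ?_ ?_ ?_
  · filter_upwards [Ioo_mem_nhdsGT hδ] with ε hε
    exact (hIntg ε hε).aestronglyMeasurable
  · filter_upwards [Ioo_mem_nhdsGT hδ] with ε hε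
    filter_upwards [hHfin, ae_restrict_of_ae hMb, ae_restrict_of_ae (pkg_leb P),
      ae_restrict_mem hS.measurableSet] with x hHx hx2 hL hxS
    have hx := hx2 hxS
    have hxΩ := hSΩ hxS
    have key : ‖MO K (D β) ε x‖ₑ * ‖D' γ x‖ₑ ≤ M * Hs x := by
      refine hx _ _ h _ _ ?_
        (deriv_le_LL P.W hγ hxΩ (P.hD' γ hγ).2.1 (hL γ hγ hxΩ).2)
      rw [mo_eq hε.1 (hball ε hε x hxS)]
      calc _ ≤ ENNReal.ofReal (ρ x ^ (∑ i, β i)) * (C * Av ε (fun y => ‖D β y‖ₑ) x) :=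
            mul_le_mul_right (hCb ε hε.1 x (D β)) _
        _ = C * (ENNReal.ofReal (ρ x ^ (∑ i, β i)) * Av ε (fun y => ‖D β y‖ₑ) x) := by ring
        _ ≤ C * (2 ^ (∑ i, β i) * LL ρ (GG ρ m D (∑ i, β i)) x) :=
            mul_le_mul_right (av_le_LL P.W D hβ ⟨hε.1, hε.2.trans_le (hδρ x hxS)⟩) _
        _ = _ := by ring
    have key2 := ENNReal.toReal_mono (ENNReal.mul_ne_top hM hHx.ne) key
    rw [ENNReal.toReal_mul, toReal_enorm, toReal_enorm] at key2
    calc ‖D' γ x * (MO K (D β) ε x * φ x)‖ = (‖MO K (D β) ε x‖ * ‖D' γ x‖) * ‖φ x‖ := by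
          rw [norm_mul, norm_mul]; ring
      _ ≤ _ := mul_le_mul key2 (hB x hxS) (norm_nonneg _) ENNReal.toReal_nonneg
  · refine Integrable.mul_const ?_ _
    refine integrable_toReal_of_lintegral_ne_top (P.meas.const_mul _).aemeasurable ?_
    rw [lintegral_const_mul' _ _ hM]
    exact ENNReal.mul_ne_top hM (pkg_int P hS)
  · refine (ae_restrict_iff' hS.measurableSet).2 ?_
    filter_upwards [pkg_leb P] with x hL hxS
    have hxΩ := hSΩ hxS
    have := lebPt_tendsto (hL β hβ hxΩ).1 hδ (hiβ.mono_set (ball_subset_closedBall.trans (hSK x hxS)))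
    have h2 : Tendsto (fun ε => MO K (D β) ε x) (𝓝[>] 0) (𝓝 (D β x)) := by
      refine this.congr' ?_
      filter_upwards [Ioo_mem_nhdsGT hδ] with ε hε
      exact (mo_eq hε.1 (hball ε hε x hxS)).symm
    exact (h2.mul_const _).const_mul _

lemma pderivI_mul {f g : Ed d → ℝ} (hf : Smth f) (hg : Smth g) (i : Fin d) (x : Ed d) :
    pderivI d i (fun x => f x * g x) x = pderivI d i f x * g x + f x * pderivI d i g x := by
  unfold pderivI
  have h3 := ((smth_differentiable hf x).hasFDerivAt.mul (smth_differentiable hg x).hasFDerivAt).fderiv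
  have : (fun x => f x * g x) = f * g := rfl
  rw [this, h3]
  simp
  ring

/-- One-step Leibniz rule. -/
lemma prod_step (P : Pkg Ω ρ m a p u v D D' Hs κ)
    {β γ : Fin d → ℕ} (h : ∑ i, β i + ∑ i, γ i + 1 ≤ m) (i : Fin d) {φ : Ed d → ℝ}
    (hφ : IsTestFun d Ω φ) :
    ∫ x, (D β x * D' γ x) * pderivI d i φ x =
      - ∫ x, (D (β + ee i) x * D' γ x + D β x * D' (γ + ee i) x) * φ x := by
  have hβ : β ∈ multiIdx d m := mem_multiIdx.2 (by omega)
  have hγ : γ ∈ multiIdx d m := mem_multiIdx.2 (by omega)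
  have hβi : β + ee i ∈ multiIdx d m := mem_multiIdx.2 (by rw [sum_add_single]; omega)
  have hγi : γ + ee i ∈ multiIdx d m := mem_multiIdx.2 (by rw [sum_add_single]; omega)
  set S := tsupport φ with hSdef
  have hS : IsCompact S := hφ.2.1
  obtain ⟨c, hc, hcS⟩ := hS.exists_forall_le' (wt_cont P.W).continuousOn
    (fun x hx => (P.W.dom x).1 (hφ.2.2 hx))
  set δ := c / 4 with hδdef
  have hδ : 0 < δ := by positivity
  set K := cthickening δ S
  have hK : IsCompact K := hS.cthickening
  have hSK : ∀ x ∈ S, closedBall x δ ⊆ K := fun x hx => closedBall_subset_cthickening hx δ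
  have hδρ : ∀ x ∈ S, δ ≤ ρ x / 2 := fun x hx => by have := hcS x hx; linarith
  have hKΩ : K ⊆ Ω := by
    intro y hy
    rw [show K = _ from hS.cthickening_eq_biUnion_closedBall hδ.le] at hy
    simp only [mem_iUnion] at hy
    obtain ⟨x, hx, hyx⟩ := hy
    exact wt_sub P.W (hφ.2.2 hx) (closedBall_subset_closedBall (hδρ x hx) hyx)
  have hφ0 : ∀ x, x ∉ S → φ x = 0 := fun x hx => image_eq_zero_of_notMem_tsupport hx
  have hφ' := test_pderivI hφ i
  have hφ'0 : ∀ x, x ∉ S → pderivI d i φ x = 0 := by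
    intro x hx
    unfold pderivI
    have : fderiv ℝ φ x = 0 := by
      by_contra hne
      exact hx ((support_fderiv_subset ℝ) hne)
    rw [this]; simp
  obtain ⟨i1, l1⟩ := moll_lim P (β := β) (γ := γ) (by omega) hS hK hKΩ hδ hSK hδρ
    hφ'.1.continuous hφ'0
  obtain ⟨i2, l2⟩ := moll_lim P (β := β + ee i) (γ := γ) (by rw [sum_add_single]; omega) hS hK hKΩ
    hδ hSK hδρ hφ.1.continuous hφ0
  obtain ⟨i3, l3⟩ := moll_lim P (β := β) (γ := γ + ee i) (by rw [sum_add_single]; omega) hS hK hKΩ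
    hδ hSK hδρ hφ.1.continuous hφ0
  have hiβ : IntegrableOn (D β) K := (P.hD β hβ).2.1.integrableOn_compact_subset hKΩ hK
  have hid : ∀ ε ∈ Ioo 0 δ, (∫ x, D' γ x * (MO K (D (β + ee i)) ε x * φ x)) +
      (∫ x, D' γ x * (MO K (D β) ε x * pderivI d i φ x)) =
      - ∫ x, D' (γ + ee i) x * (MO K (D β) ε x * φ x) := by
    intro ε hε
    have hsm := mo_smooth hK.measurableSet hiβ hε.1
    have htest : IsTestFun d Ω (fun x => MO K (D β) ε x * φ x) :=
      ⟨hsm.mul hφ.1, hφ.2.1.mul_left, (tsupport_mul_subset_right).trans hφ.2.2⟩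
    rw [← weak_step (P.hD' γ hγ) (P.hD' _ hγi) htest, ← integral_add (i2 ε hε) (i1 ε hε)]
    congr 1
    ext x
    rw [pderivI_mul hsm hφ.1, ← mul_add]
    congr 2
    by_cases hx : x ∈ S
    · have hb : closedBall x ε ⊆ K := (closedBall_subset_closedBall hε.2.le).trans (hSK x hx)
      rw [mo_deriv hK.measurableSet hiβ hε.1 i hb, mo_eq hε.1 hb,
        weak_step (P.hD β hβ) (P.hD _ hβi) (ker_test (psi_isKer d) hε.1 (hb.trans hKΩ)), neg_neg]
    · rw [hφ0 x hx, mul_zero, mul_zero]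
  have hlim := tendsto_nhds_unique_of_eventuallyEq (l2.add l1) l3.neg (by
    filter_upwards [Ioo_mem_nhdsGT hδ] with ε hε
    exact hid ε hε)
  have J : ∀ {β γ : Fin d → ℕ}, ∑ i, β i + ∑ i, γ i ≤ m →
      Integrable (fun x => (D β x * D' γ x) * φ x) := by
    intro β γ hβγ
    have h1 := ((pkg_locint P hβγ).integrableOn_compact_subset hφ.2.2 hS).mul_continuousOn
      hφ.1.continuous.continuousOn hS
    rwa [integrableOn_iff_integrable_of_support_subset] at h1
    intro x hx
    by_contra hxS
    exact hx (by simp [hφ0 x hxS])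
  have e1 : ∫ x, (D β x * D' γ x) * pderivI d i φ x = ∫ x, D' γ x * (D β x * pderivI d i φ x) := by
    congr 1; ext x; ring
  have e2 : ∫ x, (D (β + ee i) x * D' γ x + D β x * D' (γ + ee i) x) * φ x =
      (∫ x, D' γ x * (D (β + ee i) x * φ x)) + ∫ x, D' (γ + ee i) x * (D β x * φ x) := by
    simp only [add_mul]
    rw [integral_add (J (by rw [sum_add_single]; omega)) (J (by rw [sum_add_single]; omega))]
    congr 2 <;> · ext x; ring
  rw [e1, e2]
  linarith

end pkg


lemma pkg_Jint {d : ℕ} {Ω : Set (Ed d)} {ρ : Ed d → ℝ} {m : ℕ} {a p : ℝ} {u v : Ed d → ℝ}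
    {D D' : (Fin d → ℕ) → Ed d → ℝ} {Hs : Ed d → ℝ≥0∞} {κ : ℝ≥0∞}
    (P : Pkg Ω ρ m a p u v D D' Hs κ)
    {β γ : Fin d → ℕ} (hβγ : ∑ i, β i + ∑ i, γ i ≤ m) {φ : Ed d → ℝ} (hφ : IsTestFun d Ω φ) :
    Integrable (fun x => (D β x * D' γ x) * φ x) := by
  have h1 := ((pkg_locint P hβγ).integrableOn_compact_subset hφ.2.2 hφ.2.1).mul_continuousOn
    hφ.1.continuous.continuousOn hφ.2.1
  rwa [integrableOn_iff_integrable_of_support_subset] at h1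
  intro x hx
  by_contra hxS
  exact hx (by simp [image_eq_zero_of_notMem_tsupport hxS])

lemma idx_sum_add {d : ℕ} {α β γ : Fin d → ℕ} (h : β + γ = α) :
    ∑ i, β i + ∑ i, γ i = ∑ i, α i := by
  rw [← h, ← Finset.sum_add_distrib]; rfl

/-- Leibniz rule of all orders, with index sets depending only on the multi-index. -/
lemma leibniz_all {d : ℕ} (α : Fin d → ℕ) : ∃ (ι : Type) (_ : Fintype ι)
    (Q : ι → (Fin d → ℕ) × (Fin d → ℕ)), (∀ j, (Q j).1 + (Q j).2 = α) ∧
    ∀ {Ω : Set (Ed d)} {ρ : Ed d → ℝ} {m : ℕ} {a p : ℝ} {u v : Ed d → ℝ}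
    {D D' : (Fin d → ℕ) → Ed d → ℝ} {Hs : Ed d → ℝ≥0∞} {κ : ℝ≥0∞}
    (_ : Pkg Ω ρ m a p u v D D' Hs κ) (_ : ∑ i, α i ≤ m) {φ : Ed d → ℝ} (_ : IsTestFun d Ω φ),
    ∫ x, (D 0 x * D' 0 x) * pderivA d α φ x =
      (-1 : ℝ) ^ (∑ i, α i) * ∫ x, (∑ j, D (Q j).1 x * D' (Q j).2 x) * φ x := by
  induction α using idx_induction with
  | h0 =>
    refine ⟨Unit, inferInstance, fun _ => (0, 0), fun _ => by simp, ?_⟩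
    intro Ω ρ m a p u v D D' Hs κ P h φ hφ
    simp [pderivA_zero]
  | hs α i ih =>
    obtain ⟨ι, _, Q, hQ, hQ2⟩ := ih
    refine ⟨ι ⊕ ι, inferInstance, Sum.elim (fun j => ((Q j).1 + ee i, (Q j).2))
      (fun j => ((Q j).1, (Q j).2 + ee i)), ?_, ?_⟩
    · rintro (j | j)
      · simp only [Sum.elim_inl]; rw [← hQ j]; abel
      · simp only [Sum.elim_inr]; rw [← hQ j]; abel
    intro Ω ρ m a p u v D D' Hs κ P h φ hφ
    rw [sum_add_single] at h ⊢
    have hs : ∀ j, ∑ i, (Q j).1 i + ∑ i, (Q j).2 i = ∑ i, α i := fun j => idx_sum_add (hQ j)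
    rw [pderivA_succ α i hφ.1, hQ2 P (by omega) (test_pderivI hφ i), pow_succ, mul_assoc]
    congr 1
    simp only [Finset.sum_mul, Fintype.sum_sum_type, Sum.elim_inl, Sum.elim_inr]
    rw [integral_finsetSum _ (fun j _ => pkg_Jint P (by rw [hs]; omega) (test_pderivI hφ i)),
      ← Finset.sum_congr rfl (fun j _ => (prod_step P (by rw [hs]; omega) i hφ).symm)]
    simp only [add_mul, Finset.sum_mul]
    have I1 : ∀ j, Integrable (fun x => (D ((Q j).1 + ee i) x * D' (Q j).2 x) * φ x) := fun j =>
      pkg_Jint P (by rw [sum_add_single]; have := hs j; omega) hφ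
    have I2 : ∀ j, Integrable (fun x => (D (Q j).1 x * D' ((Q j).2 + ee i) x) * φ x) := fun j =>
      pkg_Jint P (by rw [sum_add_single]; have := hs j; omega) hφ
    rw [integral_add (integrable_finsetSum _ fun j _ => I1 j) (integrable_finsetSum _ fun j _ => I2 j),
      integral_finsetSum _ (fun j _ => I1 j), integral_finsetSum _ (fun j _ => I2 j),
      ← Finset.sum_add_distrib]
    rw [Finset.mul_sum]
    refine Finset.sum_congr rfl fun j _ => ?_
    rw [integral_add (I1 j) (I2 j)]
    ring

/-- Uniqueness of weak derivatives. -/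
lemma weak_unique {d : ℕ} {Ω : Set (Ed d)} (hΩ : IsOpen Ω) {α : Fin d → ℕ} {u v w : Ed d → ℝ}
    (hv : HasWeakDerivOn d Ω α u v) (hw : HasWeakDerivOn d Ω α u w) :
    ∀ᵐ x, x ∈ Ω → v x = w x := by
  have := hΩ.ae_eq_zero_of_integral_contDiff_smul_eq_zero (f := fun x => v x - w x)
    (hv.2.1.sub hw.2.1) (μ := volume) ?_
  · filter_upwards [this] with x hx hxΩ
    exact sub_eq_zero.1 (hx hxΩ)
  intro g hg hgc hgs
  have ht : IsTestFun d Ω g := ⟨hg, hgc, hgs⟩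
  have h1 := weak_pair hv ht
  rw [weak_pair hw ht] at h1
  have h2 := mul_left_cancel₀ (pow_ne_zero _ (by norm_num)) h1
  have J : ∀ {f : Ed d → ℝ}, LocallyIntegrableOn f Ω volume → Integrable (fun x => f x * g x) := by
    intro f hf
    have h1 := (hf.integrableOn_compact_subset hgs hgc).mul_continuousOn
      hg.continuous.continuousOn hgc
    rwa [integrableOn_iff_integrable_of_support_subset] at h1
    intro x hx
    by_contra hxS
    exact hx (by simp [image_eq_zero_of_notMem_tsupport hxS])
  have : ∀ x, g x • (v x - w x) = v x * g x - w x * g x := by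
    intro x; simp only [smul_eq_mul]; ring
  simp only [this]
  rw [integral_sub (J hv.2.1) (J hw.2.1), h2, sub_self]

lemma weak_zero_ae {d : ℕ} {Ω : Set (Ed d)} (hΩ : IsOpen Ω) {u v : Ed d → ℝ}
    (hv : HasWeakDerivOn d Ω 0 u v) : ∀ᵐ x, x ∈ Ω → u x = v x := by
  refine weak_unique hΩ (α := 0) ⟨hv.1, hv.1, ?_⟩ hv
  intro φ hφ
  simp [pderivA_zero]

lemma locInt_congr {d : ℕ} {Ω : Set (Ed d)} (hΩ : IsOpen Ω) {f g : Ed d → ℝ}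
    (h : ∀ᵐ x, x ∈ Ω → f x = g x) (hf : LocallyIntegrableOn f Ω volume) :
    LocallyIntegrableOn g Ω volume := by
  rw [locallyIntegrableOn_iff hΩ.isLocallyClosed] at hf ⊢
  intro S hSΩ hS
  refine (hf S hSΩ hS).congr_fun_ae ?_
  rw [EventuallyEq, ae_restrict_iff' hS.measurableSet]
  filter_upwards [h] with x hx hxS
  exact hx (hSΩ hxS)

lemma weak_prod {d : ℕ} {Ω : Set (Ed d)} {ρ : Ed d → ℝ} {m : ℕ} {a p : ℝ} {u v : Ed d → ℝ}
    {D D' : (Fin d → ℕ) → Ed d → ℝ} {Hs : Ed d → ℝ≥0∞} {κ : ℝ≥0∞}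
    (P : Pkg Ω ρ m a p u v D D' Hs κ) {α : Fin d → ℕ} (hα : α ∈ multiIdx d m)
    {ι : Type} [Fintype ι] {Q : ι → (Fin d → ℕ) × (Fin d → ℕ)} (hQ : ∀ j, (Q j).1 + (Q j).2 = α)
    (h : ∀ {φ : Ed d → ℝ} (_ : IsTestFun d Ω φ), ∫ x, (D 0 x * D' 0 x) * pderivA d α φ x =
      (-1 : ℝ) ^ (∑ i, α i) * ∫ x, (∑ j, D (Q j).1 x * D' (Q j).2 x) * φ x) :
    HasWeakDerivOn d Ω α (u * v) (fun x => ∑ j, D (Q j).1 x * D' (Q j).2 x) := by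
  have hΩ := wt_open P.W
  have h0 : (0 : Fin d → ℕ) ∈ multiIdx d m := mem_multiIdx.2 (by simp)
  have hα' := mem_multiIdx.1 hα
  have hae : ∀ᵐ x, x ∈ Ω → D 0 x * D' 0 x = (u * v) x := by
    filter_upwards [weak_zero_ae hΩ (P.hD 0 h0), weak_zero_ae hΩ (P.hD' 0 h0)] with x h1 h2 hx
    rw [Pi.mul_apply, h1 hx, h2 hx]
  refine ⟨locInt_congr hΩ hae (pkg_locint P (by simp)), ?_, ?_⟩
  · rw [locallyIntegrableOn_iff hΩ.isLocallyClosed]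
    intro S hSΩ hS
    refine integrable_finsetSum _ fun j _ => ?_
    exact (pkg_locint P (by rw [idx_sum_add (hQ j)]; exact hα')).integrableOn_compact_subset hSΩ hS
  · intro φ hφ
    rw [test_setInt hφ (fun x => ∑ j, D (Q j).1 x * D' (Q j).2 x), ← h hφ,
      ← test_setInt (test_pderivA α hφ) (fun x => D 0 x * D' 0 x)]
    apply setIntegral_congr_ae hΩ.measurableSet
    filter_upwards [hae] with x hx hxΩ
    rw [hx hxΩ]


lemma wt_model (d ℓ : ℕ) : Wt (rhoModel d ℓ) (ModelDomain d ℓ) := by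
  set T : Ed d → Ed d := fun x => WithLp.toLp 2 (fun i => if (i : ℕ) < d - ℓ then x i else 0) with hT
  have hn : ∀ x, Real.sqrt (∑ i ∈ Finset.univ.filter (fun i : Fin d => (i : ℕ) < d - ℓ), (x i) ^ 2)
      = ‖T x‖ := by
    intro x
    rw [EuclideanSpace.norm_eq, Finset.sum_filter]
    congr 1
    refine Finset.sum_congr rfl fun i _ => ?_
    simp only [hT]
    split_ifs <;> simp
  have hlip : ∀ x y, ‖T x - T y‖ ≤ ‖x - y‖ := by
    intro x y
    rw [EuclideanSpace.norm_eq, EuclideanSpace.norm_eq]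
    apply Real.sqrt_le_sqrt
    refine Finset.sum_le_sum fun i _ => ?_
    simp only [hT, PiLp.sub_apply]
    split_ifs
    · exact le_rfl
    · simp only [sub_self, norm_zero]; exact (zero_pow two_ne_zero).trans_le (sq_nonneg _)
  have hr : ∀ x, rhoModel d ℓ x = min 1 ‖T x‖ := fun x => by rw [rhoModel, hn]
  refine ⟨?_, ?_, ?_, ?_⟩
  · intro x y
    rw [hr, hr, dist_eq_norm]
    refine le_trans ?_ ((abs_norm_sub_norm_le (T x) (T y)).trans (hlip x y))
    refine (abs_min_sub_min_le_max _ _ _ _).trans ?_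
    simp
  · intro x; rw [hr]; exact le_min zero_le_one (norm_nonneg _)
  · intro x; rw [hr]; exact min_le_left _ _
  · intro x
    rw [hr, lt_min_iff, norm_pos_iff]
    simp only [ModelDomain, RStar, mem_compl_iff, mem_ofPred_eq, zero_lt_one, true_and, ne_eq]
    rw [not_iff_not]
    constructor
    · intro h
      ext i
      simp only [hT, PiLp.zero_apply]
      split_ifs with hi
      · exact h i hi
      · rfl
    · intro h i hi
      have : T x i = 0 := by rw [h]; rfl
      simpa [hT, hi] using this

lemma ofReal_kIntegrand {d : ℕ} {ρ : Ed d → ℝ} (hρ : ∀ x, 0 ≤ ρ x) {a p : ℝ} (hp : 0 ≤ p)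
    (α : Fin d → ℕ) (v : Ed d → ℝ) (x : Ed d) : ENNReal.ofReal (kIntegrand d ρ a p α v x) =
      (ENNReal.ofReal (ρ x ^ (((∑ i, α i : ℕ) : ℝ) - a)) * ‖v x‖ₑ) ^ p := by
  have h1 : 0 ≤ ρ x ^ (((∑ i, α i : ℕ) : ℝ) - a) := Real.rpow_nonneg (hρ x) _
  rw [kIntegrand, ← ENNReal.ofReal_rpow_of_nonneg (mul_nonneg h1 (abs_nonneg _)) hp,
    ENNReal.ofReal_mul h1, Real.enorm_eq_ofReal_abs]

lemma kIntegrand_nonneg {d : ℕ} {ρ : Ed d → ℝ} (hρ : ∀ x, 0 ≤ ρ x) {a p : ℝ}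
    (α : Fin d → ℕ) (v : Ed d → ℝ) (x : Ed d) : 0 ≤ kIntegrand d ρ a p α v x :=
  Real.rpow_nonneg (mul_nonneg (Real.rpow_nonneg (hρ x) _) (abs_nonneg _)) _

lemma kIntegrand_meas {d : ℕ} {Ω : Set (Ed d)} {ρ : Ed d → ℝ} (W : Wt ρ Ω) {a p : ℝ}
    {α : Fin d → ℕ} {v : Ed d → ℝ} (hv : LocallyIntegrableOn v Ω volume) :
    AEStronglyMeasurable (kIntegrand d ρ a p α v) (volume.restrict Ω) := by
  have h1 : AEMeasurable v (volume.restrict Ω) := hv.aestronglyMeasurable.aemeasurable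
  have h2 : Measurable ρ := (wt_cont W).measurable
  have h3 : AEMeasurable (fun x => |v x|) (volume.restrict Ω) := h1.norm
  exact (((h2.pow_const _).aemeasurable.mul h3).pow_const p).aestronglyMeasurable

lemma data_EE {d : ℕ} {Ω : Set (Ed d)} {ρ : Ed d → ℝ} (W : Wt ρ Ω) {m : ℕ} {a p : ℝ} (hp : 1 < p)
    {u : Ed d → ℝ} {D : (Fin d → ℕ) → Ed d → ℝ} (h : KMemData d Ω ρ m a p u D) :
    EE Ω ρ m a p D ≠ ⊤ ∧ KnormP d Ω ρ m a p D = ((EE Ω ρ m a p D) ^ (1 / p)).toReal := by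
  have hp0 : 0 ≤ p := by linarith
  have hfin : ∀ α ∈ multiIdx d m, ∫⁻ x in Ω,
      (ENNReal.ofReal (ρ x ^ (((∑ i, α i : ℕ) : ℝ) - a)) * ‖D α x‖ₑ) ^ p ≠ ⊤ := by
    intro α hα
    have := (h.2 α hα).2
    rw [hasFiniteIntegral_iff_ofReal (ae_of_all _ (kIntegrand_nonneg W.nonneg α _))] at this
    simp only [ofReal_kIntegrand W.nonneg hp0] at this
    exact this.ne
  refine ⟨ENNReal.sum_ne_top.2 hfin, ?_⟩
  rw [← ENNReal.toReal_rpow, EE, ENNReal.toReal_sum hfin, KnormP]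
  congr 1
  refine Finset.sum_congr rfl fun α hα => ?_
  rw [integral_eq_lintegral_of_nonneg_ae (ae_of_all _ (kIntegrand_nonneg W.nonneg α _)) (h.2 α hα).1]
  simp only [ofReal_kIntegrand W.nonneg hp0]

lemma EE_data {d : ℕ} {Ω : Set (Ed d)} {ρ : Ed d → ℝ} (W : Wt ρ Ω) {m : ℕ} {a p : ℝ} (hp : 1 < p)
    {u : Ed d → ℝ} {D : (Fin d → ℕ) → Ed d → ℝ} (h : IsWeakDerivFamily d Ω m u D)
    (hE : EE Ω ρ m a p D ≠ ⊤) : KMemData d Ω ρ m a p u D := by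
  have hp0 : 0 ≤ p := by linarith
  refine ⟨h, fun α hα => ⟨kIntegrand_meas W (h α hα).2.1, ?_⟩⟩
  rw [hasFiniteIntegral_iff_ofReal (ae_of_all _ (kIntegrand_nonneg W.nonneg α _))]
  simp only [ofReal_kIntegrand W.nonneg hp0]
  exact (ENNReal.sum_ne_top.1 hE α hα).lt_top

lemma EE_congr {d : ℕ} {Ω : Set (Ed d)} {ρ : Ed d → ℝ} (W : Wt ρ Ω) {m : ℕ} {a p : ℝ}
    {u : Ed d → ℝ} {D D' : (Fin d → ℕ) → Ed d → ℝ} (h : IsWeakDerivFamily d Ω m u D)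
    (h' : IsWeakDerivFamily d Ω m u D') : EE Ω ρ m a p D = EE Ω ρ m a p D' := by
  refine Finset.sum_congr rfl fun α hα => ?_
  refine lintegral_congr_ae ?_
  rw [EventuallyEq, ae_restrict_iff' (wt_open W).measurableSet]
  filter_upwards [weak_unique (wt_open W) (h α hα) (h' α hα)] with x hx hxΩ
  rw [hx hxΩ]

lemma knorm_eq {d : ℕ} {Ω : Set (Ed d)} {ρ : Ed d → ℝ} (W : Wt ρ Ω) {m : ℕ} {a p : ℝ} (hp : 1 < p)
    {u : Ed d → ℝ} {D : (Fin d → ℕ) → Ed d → ℝ} (h : KMemData d Ω ρ m a p u D) :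
    Knorm d Ω ρ m a p u = ((EE Ω ρ m a p D) ^ (1 / p)).toReal := by
  have hM : MemK d Ω ρ m a p u := ⟨D, h⟩
  rw [Knorm, dif_pos hM, (data_EE W hp hM.choose_spec).2, EE_congr W hM.choose_spec.1 h.1]

lemma prod_pointwise {d : ℕ} {Ω : Set (Ed d)} {ρ : Ed d → ℝ} {m : ℕ} {a p : ℝ} {u v : Ed d → ℝ}
    {D D' : (Fin d → ℕ) → Ed d → ℝ} {Hs : Ed d → ℝ≥0∞} {κ : ℝ≥0∞}
    (P : Pkg Ω ρ m a p u v D D' Hs κ) {α : Fin d → ℕ} (hα : α ∈ multiIdx d m)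
    {ι : Type} [Fintype ι] {Q : ι → (Fin d → ℕ) × (Fin d → ℕ)} (hQ : ∀ j, (Q j).1 + (Q j).2 = α) :
    ∀ᵐ x, x ∈ Ω → ENNReal.ofReal (ρ x ^ (((∑ i, α i : ℕ) : ℝ) - a)) *
      ‖∑ j, D (Q j).1 x * D' (Q j).2 x‖ₑ ≤
      ((Fintype.card ι : ℝ≥0∞) * (2 ^ (∑ i, α i) * κ)) * Hs x := by
  have hα' := mem_multiIdx.1 hα
  filter_upwards [P.bd, pkg_leb P] with x hb hL hx
  have hρ := (P.W.dom x).1 hx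
  have key : ∀ j, ENNReal.ofReal (ρ x ^ (((∑ i, α i : ℕ) : ℝ) - a)) *
      (‖D (Q j).1 x‖ₑ * ‖D' (Q j).2 x‖ₑ) ≤ (2 ^ (∑ i, α i) * κ) * Hs x := by
    intro j
    have hs := idx_sum_add (hQ j)
    set β := (Q j).1
    set γ := (Q j).2
    have hβ : β ∈ multiIdx d m := mem_multiIdx.2 (by omega)
    have hγ : γ ∈ multiIdx d m := mem_multiIdx.2 (by omega)
    have e1 : ENNReal.ofReal (ρ x ^ (((∑ i, α i : ℕ) : ℝ) - a)) =
        ENNReal.ofReal (ρ x ^ (-a)) * (ENNReal.ofReal (ρ x ^ (∑ i, β i)) *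
          ENNReal.ofReal (ρ x ^ (∑ i, γ i))) := by
      rw [← ENNReal.ofReal_mul (by positivity), ← ENNReal.ofReal_mul (by positivity), ← pow_add, hs,
        ← Real.rpow_natCast, ← Real.rpow_add hρ]
      congr 2; ring
    have e2 : ENNReal.ofReal (ρ x ^ (-a)) * ENNReal.ofReal (ρ x ^ a) = 1 := by
      rw [← ENNReal.ofReal_mul (by positivity), ← Real.rpow_add hρ]; simp
    have g1 := deriv_le_LL P.W hβ hx (P.hD β hβ).2.1 (hL β hβ hx).1
    have g2 := deriv_le_LL P.W hγ hx (P.hD' γ hγ).2.1 (hL γ hγ hx).2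
    calc _ = ENNReal.ofReal (ρ x ^ (-a)) * ((ENNReal.ofReal (ρ x ^ (∑ i, β i)) * ‖D β x‖ₑ) *
          (ENNReal.ofReal (ρ x ^ (∑ i, γ i)) * ‖D' γ x‖ₑ)) := by rw [e1]; ring
      _ ≤ ENNReal.ofReal (ρ x ^ (-a)) * ((2 ^ (∑ i, β i) * LL ρ (GG ρ m D (∑ i, β i)) x) *
          (2 ^ (∑ i, γ i) * LL ρ (GG ρ m D' (∑ i, γ i)) x)) :=
          mul_le_mul_right (mul_le_mul' g1 g2) _
      _ = ENNReal.ofReal (ρ x ^ (-a)) * 2 ^ (∑ i, α i) * (LL ρ (GG ρ m D (∑ i, β i)) x *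
          LL ρ (GG ρ m D' (∑ i, γ i)) x) := by rw [← hs, pow_add]; ring
      _ ≤ ENNReal.ofReal (ρ x ^ (-a)) * 2 ^ (∑ i, α i) * (κ * (ENNReal.ofReal (ρ x ^ a) * Hs x)) :=
          mul_le_mul_right (hb hx _ _ (by omega)) _
      _ = (ENNReal.ofReal (ρ x ^ (-a)) * ENNReal.ofReal (ρ x ^ a)) *
          ((2 ^ (∑ i, α i) * κ) * Hs x) := by ring
      _ = _ := by rw [e2, one_mul]
  calc _ ≤ ENNReal.ofReal (ρ x ^ (((∑ i, α i : ℕ) : ℝ) - a)) *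
        ∑ j, ‖D (Q j).1 x‖ₑ * ‖D' (Q j).2 x‖ₑ := by
        refine mul_le_mul_right ((enorm_sum_le _ _).trans (le_of_eq ?_)) _
        simp only [enorm_mul]
    _ ≤ ∑ j : ι, (2 ^ (∑ i, α i) * κ) * Hs x := by
        rw [Finset.mul_sum]
        exact Finset.sum_le_sum fun j _ => key j
    _ = _ := by
        rw [Finset.sum_const, nsmul_eq_mul, Finset.card_univ]; ring

lemma moser_EE (d m : ℕ) (hm : 1 ≤ m) (a p : ℝ) (hp : 1 < p) : ∃ C : ℝ≥0∞, C ≠ ⊤ ∧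
    ∀ (Ω : Set (Ed d)) (ρ : Ed d → ℝ) (_ : Wt ρ Ω)
    (u v : Ed d → ℝ) (D D' : (Fin d → ℕ) → Ed d → ℝ), IsWeakDerivFamily d Ω m u D →
    IsWeakDerivFamily d Ω m v D' → eLpNorm u ⊤ volume ≠ ⊤ → eLpNorm v ⊤ volume ≠ ⊤ →
    EE Ω ρ m a p D ≠ ⊤ → EE Ω ρ m a p D' ≠ ⊤ → ∃ F, IsWeakDerivFamily d Ω m (u * v) F ∧
      EE Ω ρ m a p F ≤ C * (eLpNorm u ⊤ volume ^ p * EE Ω ρ m a p D' +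
        eLpNorm v ⊤ volume ^ p * EE Ω ρ m a p D) := by
  obtain ⟨κ, C, hκ, hC, H⟩ := pkg_exists d m hm a p hp
  have hp0 : 0 ≤ p := by linarith
  choose ι hι Q hQ hQ2 using fun α : Fin d → ℕ => leibniz_all (d := d) α
  set B : (Fin d → ℕ) → ℝ≥0∞ := fun α => (Fintype.card (ι α) : ℝ≥0∞) * (2 ^ (∑ i, α i) * κ) with hB
  have hBf : ∀ α, B α ^ p ≠ ⊤ := fun α => ENNReal.rpow_ne_top_of_nonneg hp0
    (ENNReal.mul_ne_top (by simp) (ENNReal.mul_ne_top (by simp) hκ))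
  refine ⟨(∑ α ∈ multiIdx d m, B α ^ p) * C,
    ENNReal.mul_ne_top (ENNReal.sum_ne_top.2 fun α _ => hBf α) hC, ?_⟩
  intro Ω ρ W u v D D' hD hD' hU hV hE hE'
  obtain ⟨Hs, P, hHs⟩ := H Ω ρ W u v D D' hD hD' hU hV hE hE'
  refine ⟨fun α x => ∑ j, D (Q α j).1 x * D' (Q α j).2 x, ?_, ?_⟩
  · intro α hα
    exact weak_prod P hα (hQ α) (fun hφ => hQ2 α P (mem_multiIdx.1 hα) hφ)
  rw [mul_assoc]
  refine le_trans ?_ (mul_le_mul_right hHs _)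
  rw [EE, Finset.sum_mul]
  refine Finset.sum_le_sum fun α hα => ?_
  calc _ ≤ ∫⁻ x in Ω, B α ^ p * Hs x ^ p := by
        apply lintegral_mono_ae
        rw [ae_restrict_iff' (wt_open W).measurableSet]
        filter_upwards [prod_pointwise P hα (hQ α)] with x hx hxΩ
        rw [← ENNReal.mul_rpow_of_nonneg _ _ hp0]
        exact ENNReal.rpow_le_rpow (hx hxΩ) hp0
    _ ≤ ∫⁻ x, B α ^ p * Hs x ^ p := setLIntegral_le_lintegral _ _
    _ = _ := lintegral_const_mul' _ _ (hBf α)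

lemma moser_final (d ℓ m : ℕ) (hm : 1 ≤ m) (a p : ℝ) (hp : 1 < p) :
    ∃ c : ℝ, 0 < c ∧ ∀ u v : Ed d → ℝ,
      MemKM d ℓ m a p u → MemKM d ℓ m a p v →
      eLpNorm u ⊤ volume < ⊤ → eLpNorm v ⊤ volume < ⊤ →
      MemKM d ℓ m a p (u * v) ∧
      KnormM d ℓ m a p (u * v) ≤
        c * (KnormM d ℓ m a p u * (eLpNorm v ⊤ volume).toReal +
          KnormM d ℓ m a p v * (eLpNorm u ⊤ volume).toReal) := by
  obtain ⟨C, hC, H⟩ := moser_EE d m hm a p hp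
  have W := wt_model d ℓ
  have hp0 : 0 < p := by linarith
  have hip : (0 : ℝ) ≤ 1 / p := by positivity
  have hip1 : 1 / p ≤ 1 := by rw [div_le_one hp0]; exact hp.le
  refine ⟨(C ^ (1 / p)).toReal + 1, by positivity, ?_⟩
  rintro u v ⟨D, hD⟩ ⟨D', hD'⟩ hU hV
  have hE := (data_EE W hp hD).1
  have hE' := (data_EE W hp hD').1
  obtain ⟨F, hF, hFE⟩ := H _ _ W u v D D' hD.1 hD'.1 hU.ne hV.ne hE hE'
  rw [KnormM, KnormM, KnormM, knorm_eq W hp hD, knorm_eq W hp hD']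
  set U := eLpNorm u ⊤ volume
  set V := eLpNorm v ⊤ volume
  set E := EE (ModelDomain d ℓ) (rhoModel d ℓ) m a p D
  set E' := EE (ModelDomain d ℓ) (rhoModel d ℓ) m a p D'
  have hUp : U ^ p ≠ ⊤ := ENNReal.rpow_ne_top_of_nonneg hp0.le hU.ne
  have hVp : V ^ p ≠ ⊤ := ENNReal.rpow_ne_top_of_nonneg hp0.le hV.ne
  have hFf : EE (ModelDomain d ℓ) (rhoModel d ℓ) m a p F ≠ ⊤ := ne_top_of_le_ne_top
    (ENNReal.mul_ne_top hC (ENNReal.add_ne_top.2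
      ⟨ENNReal.mul_ne_top hUp hE', ENNReal.mul_ne_top hVp hE⟩)) hFE
  have hFD := EE_data W hp hF hFf
  refine ⟨⟨F, hFD⟩, ?_⟩
  rw [knorm_eq W hp hFD]
  have hr : ∀ X Y : ℝ≥0∞, (X ^ p * Y) ^ (1 / p) = X * Y ^ (1 / p) := by
    intro X Y
    rw [ENNReal.mul_rpow_of_nonneg _ _ hip, ← ENNReal.rpow_mul, mul_one_div_cancel hp0.ne',
      ENNReal.rpow_one]
  have hEp : E ^ (1 / p) ≠ ⊤ := ENNReal.rpow_ne_top_of_nonneg hip hE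
  have hEp' : E' ^ (1 / p) ≠ ⊤ := ENNReal.rpow_ne_top_of_nonneg hip hE'
  have hCp : C ^ (1 / p) ≠ ⊤ := ENNReal.rpow_ne_top_of_nonneg hip hC
  have main : EE (ModelDomain d ℓ) (rhoModel d ℓ) m a p F ^ (1 / p) ≤
      C ^ (1 / p) * (E ^ (1 / p) * V + E' ^ (1 / p) * U) := by
    refine (ENNReal.rpow_le_rpow hFE hip).trans ?_
    rw [ENNReal.mul_rpow_of_nonneg _ _ hip]
    refine mul_le_mul_right ((ENNReal.rpow_add_le_add_rpow _ _ hip hip1).trans (le_of_eq ?_)) _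
    rw [hr, hr]; ring
  have h1 : E ^ (1 / p) * V ≠ ⊤ := ENNReal.mul_ne_top hEp hV.ne
  have h2 : E' ^ (1 / p) * U ≠ ⊤ := ENNReal.mul_ne_top hEp' hU.ne
  have main2 := ENNReal.toReal_mono (ENNReal.mul_ne_top hCp (ENNReal.add_ne_top.2 ⟨h1, h2⟩)) main
  rw [ENNReal.toReal_mul, ENNReal.toReal_add h1 h2, ENNReal.toReal_mul, ENNReal.toReal_mul] at main2
  refine main2.trans (mul_le_mul_of_nonneg_right (by linarith) (by positivity))

/-- Theorem `thm-mult11` (Moser-type inequality): for `1 < p < ∞`, `m ∈ ℕ`, `a ∈ ℝ` there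
is a constant `c` such that
`‖u·v|𝒦^m_{a,p}‖ ≤ c (‖u|𝒦^m_{a,p}‖ ‖v‖_∞ + ‖v|𝒦^m_{a,p}‖ ‖u‖_∞)` for all
`u, v ∈ 𝒦^m_{a,p}(ℝ^d, ℝ^ℓ_*) ∩ L_∞(ℝ^d)`. -/
theorem statement17 (d ℓ m : ℕ) (hd : 2 ≤ d) (hl : ℓ < d) (hm : 1 ≤ m)
    (a p : ℝ) (hp : 1 < p) :
    ∃ c : ℝ, 0 < c ∧ ∀ u v : Ed d → ℝ,
      MemKM d ℓ m a p u → MemKM d ℓ m a p v →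
      eLpNorm u ⊤ volume < ⊤ → eLpNorm v ⊤ volume < ⊤ →
      MemKM d ℓ m a p (u * v) ∧
      KnormM d ℓ m a p (u * v) ≤
        c * (KnormM d ℓ m a p u * (eLpNorm v ⊤ volume).toReal +
          KnormM d ℓ m a p v * (eLpNorm u ⊤ volume).toReal) := by
  exact moser_final d ℓ m hm a p hp

end
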